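/- (Kottwitz–Rapoport, converse of Mazur's inequality for GL_n) Let b ∈ GL_n(L) and let (N, Φ) = (Lⁿ, b∘σ) be the associated isocrystal with Newton vector ν̄_b. If μ ∈ (ℤⁿ)₊ satisfies ν̄_b ≤ μ in the dominance order, then there exists an O-lattice M in N with inv(M, Φ(M)) = μ. -/

import Mathlib

/-!
Isocrystals over `L = Frac(W(k))`, `k` an algebraic closure of `𝔽_p`:
for `b ∈ GL_n(L)` the isocrystal `(N, Φ) = (Lⁿ, b ∘ σ)`, `O = W(k)`-lattices in `N`,
the relative position `inv(M, M')` of two lattices, the dominance order, and the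
Newton (slope) vector of an isocrystal via its Dieudonné–Manin slope decomposition.
-/

noncomputable section

open scoped Isocrystal

section IsocrystalSetup

variable (p : ℕ) [Fact p.Prime]
variable (k : Type) [Field k] [IsAlgClosed k] [CharP k p]
variable (n : ℕ)

/-- `σ`, the Frobenius automorphism of `L = K(p, k) = Frac(W(k))`. -/
abbrev frobL : K(p, k) ≃+* K(p, k) := WittVector.FractionRing.frobenius p k

/-- The `σ`-linear bijection `Φ = b ∘ σ` on `N = Lⁿ` attached to `b ∈ GL_n(L)`. -/
def isocFrob (b : GL (Fin n) (K(p, k))) (v : Fin n → K(p, k)) : Fin n → K(p, k) :=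
  (b : Matrix (Fin n) (Fin n) (K(p, k))).mulVec fun i => frobL p k (v i)

/-- `M` is an `O = W(k)`-lattice in `N = Lⁿ`: the `O`-span of an `L`-basis. -/
def IsLattice (M : Submodule (WittVector p k) (Fin n → K(p, k))) : Prop :=
  ∃ e : Fin n → (Fin n → K(p, k)),
    LinearIndependent (K(p, k)) e ∧ M = Submodule.span (WittVector p k) (Set.range e)

/-- The image `Φ(M)` of a lattice under the `σ`-linear map `Φ`, as an `O`-submodule. -/
def latImage (b : GL (Fin n) (K(p, k)))
    (M : Submodule (WittVector p k) (Fin n → K(p, k))) :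
    Submodule (WittVector p k) (Fin n → K(p, k)) :=
  Submodule.span (WittVector p k) (isocFrob p k n b '' (M : Set (Fin n → K(p, k))))

/-- The relative position `inv(M, M') = μ ∈ ℤⁿ` of two lattices (elementary divisor
theorem): there is an `O`-basis `e₁, …, e_n` of `M` such that
`p^{μ₁} e₁, …, p^{μ_n} e_n` is an `O`-basis of `M'`. -/
def RelPos (M M' : Submodule (WittVector p k) (Fin n → K(p, k))) (μ : Fin n → ℤ) : Prop :=
  ∃ e : Fin n → (Fin n → K(p, k)), LinearIndependent (K(p, k)) e ∧
    M = Submodule.span (WittVector p k) (Set.range e) ∧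
    M' = Submodule.span (WittVector p k)
      (Set.range fun i => (p : K(p, k)) ^ (μ i) • e i)

/-- Partial sum `ν₁ + … + ν_r` of a vector `ν`. -/
def partialSum (ν : Fin n → ℚ) (r : ℕ) : ℚ :=
  ∑ i ∈ Finset.univ.filter (fun i : Fin n => (i : ℕ) < r), ν i

/-- The dominance order on `ℚⁿ`: all proper partial sums are `≤`, total sums equal. -/
def DomLE (ν ν' : Fin n → ℚ) : Prop :=
  (∀ r : ℕ, r < n → partialSum n ν r ≤ partialSum n ν' r) ∧
    partialSum n ν n = partialSum n ν' n

/-- A subspace `P` of the isocrystal `(Lⁿ, Φ_b)` is isoclinic of slope `λ = s/r`: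
it admits an `O`-lattice `M` (a finitely generated `O`-submodule spanning `P`
over `L`) with `Φ^r(M) = p^s M`. -/
def IsIsoclinicOfSlope (b : GL (Fin n) (K(p, k)))
    (P : Submodule (K(p, k)) (Fin n → K(p, k))) (lam : ℚ) : Prop :=
  ∃ (r : ℕ) (s : ℤ), 0 < r ∧ lam = (s : ℚ) / (r : ℚ) ∧
    ∃ M : Submodule (WittVector p k) (Fin n → K(p, k)),
      (M : Set (Fin n → K(p, k))) ⊆ (P : Set (Fin n → K(p, k))) ∧
      Submodule.span (K(p, k)) (M : Set (Fin n → K(p, k))) = P ∧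
      (∃ S : Finset (Fin n → K(p, k)),
        M = Submodule.span (WittVector p k) (S : Set (Fin n → K(p, k)))) ∧
      Submodule.span (WittVector p k)
          ((isocFrob p k n b)^[r] '' (M : Set (Fin n → K(p, k)))) =
        Submodule.span (WittVector p k)
          ((fun x => (p : K(p, k)) ^ s • x) '' (M : Set (Fin n → K(p, k))))

/-- `ν ∈ (ℚⁿ)₊` is the Newton vector of the isocrystal `(Lⁿ, Φ_b)`: `ν` is
weakly decreasing and there is a `Φ_b`-stable slope decomposition
`Lⁿ = ⊕_λ N_λ` with `N_λ` isoclinic of slope `λ` and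
`dim N_λ = #{i : ν_i = λ}` (Dieudonné–Manin). -/
def IsNewtonVector (b : GL (Fin n) (K(p, k))) (ν : Fin n → ℚ) : Prop :=
  (∀ i j : Fin n, i ≤ j → ν j ≤ ν i) ∧
  ∃ P : ℚ → Submodule (K(p, k)) (Fin n → K(p, k)),
    iSupIndep P ∧ (⨆ lam, P lam) = ⊤ ∧
    (∀ lam, isocFrob p k n b '' (P lam : Set (Fin n → K(p, k))) ⊆ P lam) ∧
    (∀ lam, Module.finrank (K(p, k)) (P lam) =
      (Finset.univ.filter fun i : Fin n => ν i = lam).card) ∧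
    (∀ lam, P lam = ⊥ ∨ IsIsoclinicOfSlope p k n b (P lam) lam)

end IsocrystalSetup


set_option linter.unusedSectionVars false
section CyclicField
open Polynomial

/-- key determinant trick -/
theorem exists_det_ne {k : Type} [Field k] [Infinite k] {q d : ℕ} (hq : 2 ≤ q)
    (A B : Fin (d+1) → Fin (d+1) → k)
    (h : (Matrix.of (({Fin.last d} : Finset (Fin (d+1))).piecewise B A)).det ≠ 0) :
    ∃ t : k, (Matrix.of fun i j => A i j + t ^ (q ^ (i:ℕ)) * B i j).det ≠ 0 := by
  classical
  set f : k[X] := ∑ s : Finset (Fin (d+1)),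
    C ((Matrix.of (s.piecewise B A)).det) * X ^ (∑ i ∈ s, q ^ (i:ℕ)) with hf
  have hev : ∀ t, f.eval t = (Matrix.of fun i j => A i j + t ^ (q ^ (i:ℕ)) * B i j).det := by
    intro t
    have h1 := (Matrix.detRowAlternating (R := k) (n := Fin (d+1))).toMultilinearMap.map_add_univ
      (fun i => t ^ (q ^ (i:ℕ)) • B i) (fun i => A i)
    have h2 : (Matrix.of fun i j => A i j + t ^ (q ^ (i:ℕ)) * B i j).det =
      (Matrix.detRowAlternating (R := k) (n := Fin (d+1))).toMultilinearMap
        ((fun i : Fin (d+1) => t ^ (q ^ (i:ℕ)) • B i) + (fun i => A i)) := by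
      change Matrix.det _ = Matrix.det _
      congr 1
      ext i j
      simp [add_comm]
    rw [h2, h1, hf, eval_finsetSum]
    refine Finset.sum_congr rfl fun s _ => ?_
    have h3 : (s.piecewise (fun i => t ^ (q ^ (i:ℕ)) • B i) (fun i => A i)) =
        fun i => (s.piecewise (fun i => t ^ (q ^ (i:ℕ))) (fun _ => 1) i) • s.piecewise B A i := by
      funext i
      by_cases hi : i ∈ s
      · rw [Finset.piecewise_eq_of_mem _ _ _ hi, Finset.piecewise_eq_of_mem _ _ _ hi,
          Finset.piecewise_eq_of_mem _ _ _ hi]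
      · rw [Finset.piecewise_eq_of_notMem _ _ _ hi, Finset.piecewise_eq_of_notMem _ _ _ hi,
          Finset.piecewise_eq_of_notMem _ _ _ hi, one_smul]
    rw [h3, MultilinearMap.map_smul_univ]
    rw [Finset.prod_piecewise]
    simp only [eval_mul, eval_C, eval_pow, eval_X, Finset.prod_const_one, mul_one, smul_eq_mul,
      Finset.univ_inter, Finset.prod_pow_eq_pow_sum]
    rw [mul_comm]
    rfl
  have hne : f ≠ 0 := by
    intro h0
    have : f.coeff (q ^ d) = (Matrix.of (({Fin.last d} : Finset (Fin (d+1))).piecewise B A)).det := by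
      rw [hf, finsetSum_coeff, Finset.sum_eq_single {Fin.last d}]
      · simp
      · intro s _ hs
        rw [coeff_C_mul, coeff_X_pow, if_neg, mul_zero]
        intro he
        by_cases hl : Fin.last d ∈ s
        · apply hs
          rw [← Finset.add_sum_erase s _ hl] at he
          simp only [Fin.val_last] at he
          have h0 : ∑ i ∈ s.erase (Fin.last d), q ^ (i:ℕ) = 0 := by omega
          rw [Finset.sum_eq_zero_iff] at h0
          ext i
          simp only [Finset.mem_singleton]
          constructor
          · intro hi
            by_contra hne
            have := h0 i (Finset.mem_erase.2 ⟨hne, hi⟩)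
            have : 0 < q ^ (i:ℕ) := by positivity
            omega
          · rintro rfl; exact hl
        · have h1 : ∑ i ∈ s, q ^ (i:ℕ) = ∑ j ∈ s.image (fun i : Fin (d+1) => (i:ℕ)), q ^ j := by
            rw [Finset.sum_image]
            intro a _ b _ hab; exact Fin.ext hab
          have h2 := Nat.geomSum_lt (m := q) (n := d) (s := s.image (fun i : Fin (d+1) => (i:ℕ))) hq
            (by
              intro j hj
              obtain ⟨i, hi, rfl⟩ := Finset.mem_image.1 hj
              have : i ≠ Fin.last d := fun e => hl (e ▸ hi)
              exact Fin.val_lt_last this)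
          omega
      · simp
    rw [h0] at this
    exact h (by simpa using this.symm)
  by_contra! hall
  exact hne (Polynomial.funext fun t => by rw [hev, hall, eval_zero])

theorem exists_cyclic {k V : Type} [Field k] [Infinite k] [AddCommGroup V] [Module k V]
    [FiniteDimensional k V] {q : ℕ} (hq : 2 ≤ q) (Ψ : V →+ V) (hs : Function.Surjective Ψ)
    (hΨ : ∀ (c : k) x, Ψ (c • x) = c ^ q • Ψ x) :
    ∃ (v : V) (m : ℕ), LinearIndependent k (fun t : Fin m => Ψ^[t] v) ∧
      Submodule.span k (Set.range fun t : Fin m => Ψ^[t] v) = ⊤ := by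
  classical
  let Q : ℕ → Prop := fun m => ∃ v : V, LinearIndependent k (fun t : Fin m => Ψ^[t] v)
  have hQ0 : Q 0 := ⟨0, linearIndependent_empty_type⟩
  have hQb : ∀ m, Q m → m ≤ Module.finrank k V := by
    rintro m ⟨v, hv⟩
    simpa using hv.fintype_card_le_finrank
  obtain ⟨d, ⟨v, hv⟩, hmax⟩ : ∃ d, Q d ∧ ¬ Q (d+1) := by
    by_contra! hcon
    have : ∀ m, Q m := fun m => Nat.rec hQ0 (fun m ih => hcon m ih) m
    have := hQb _ (this (Module.finrank k V + 1))
    omega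
  refine ⟨v, d, hv, ?_⟩
  rw [Submodule.eq_top_iff']
  intro y
  by_contra hy
  obtain ⟨u, rfl⟩ := hs.iterate d y
  have hΨi : ∀ (i : ℕ) (c : k) x, Ψ^[i] (c • x) = c ^ (q ^ i) • Ψ^[i] x := by
    intro i
    induction i with
    | zero => intros; simp
    | succ i ih => intro c x; rw [Function.iterate_succ_apply, hΨ, ih, Function.iterate_succ_apply,
        ← pow_mul, pow_succ, mul_comm]
  have hli : LinearIndependent k (Fin.snoc (fun t : Fin d => Ψ^[t] v) (Ψ^[d] u) : Fin (d+1) → V) := by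
    rw [linearIndependent_finSnoc]
    exact ⟨hv, hy⟩
  obtain ⟨π, hπ⟩ : ∃ π : V →ₗ[k] (Fin (d+1) → k), ∀ i,
      π ((Fin.snoc (fun t : Fin d => Ψ^[t] v) (Ψ^[d] u) : Fin (d+1) → V) i) = Pi.single i 1 := by
    obtain ⟨g, hg⟩ := LinearMap.exists_leftInverse_of_injective
      (Fintype.linearCombination k (Fin.snoc (fun t : Fin d => Ψ^[t] v) (Ψ^[d] u) : Fin (d+1) → V))
      (by
        rw [LinearMap.ker_eq_bot]
        exact hli.fintypeLinearCombination_injective)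
    refine ⟨g, fun i => ?_⟩
    have := congrArg (fun F => F (Pi.single i 1)) hg
    simpa using this
  obtain ⟨t, ht⟩ := exists_det_ne hq (fun i => π (Ψ^[i] v)) (fun i => π (Ψ^[i] u)) (by
    have : (Matrix.of (({Fin.last d} : Finset (Fin (d+1))).piecewise
        (fun i : Fin (d+1) => π (Ψ^[i] u)) (fun i => π (Ψ^[i] v)))) = (1 : Matrix _ _ k) := by
      ext i j
      rw [Matrix.of_apply]
      have hi := congrFun (hπ i) j
      refine Fin.lastCases ?_ (fun i => ?_) i
      · have hi := congrFun (hπ (Fin.last d)) j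
        simp only [Fin.snoc_last] at hi
        simp [hi, Matrix.one_apply, Pi.single_apply, eq_comm]
      · have hi := congrFun (hπ i.castSucc) j
        simp only [Fin.snoc_castSucc] at hi
        have : i.castSucc ≠ Fin.last d := (Fin.castSucc_lt_last i).ne
        simp [hi, Matrix.one_apply, Pi.single_apply, eq_comm, this]
    rw [this]; simp)
  apply hmax
  refine ⟨v + t • u, ?_⟩
  have h1 : LinearIndependent k (fun i : Fin (d+1) => π (Ψ^[i] (v + t • u))) := by
    have := Matrix.linearIndependent_rows_of_det_ne_zero ht
    have hfun : (fun i : Fin (d+1) => π (Ψ^[i] (v + t • u))) = fun i => (Matrix.of fun i j =>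
        π (Ψ^[i] v) j + t ^ (q ^ (i:ℕ)) * π (Ψ^[i] u) j : Matrix (Fin (d+1)) (Fin (d+1)) k) i := ?_
    · rw [hfun]; exact this
    funext i
    ext j
    have e : Ψ^[(i:ℕ)] (v + t • u) = Ψ^[i] v + t ^ (q ^ (i:ℕ)) • Ψ^[i] u := by
      rw [iterate_map_add, hΨi]
    rw [e]
    simp
  exact LinearIndependent.of_comp π h1

end CyclicField


theorem witt_p_dvd {p : ℕ} [Fact p.Prime] {k : Type} [Field k] [IsAlgClosed k] [CharP k p]
    {a : WittVector p k} (h : a.coeff 0 = 0) : (p : WittVector p k) ∣ a := by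
  by_cases ha : a = 0
  · simp [ha]
  obtain ⟨m, b, hb, rfl⟩ := WittVector.exists_eq_pow_p_mul a ha
  cases m with
  | zero => simp at h; exact absurd h hb
  | succ m => exact Dvd.intro_left (p ^ m * b) (by ring)

theorem exists_cyclic_witt {p : ℕ} [Fact p.Prime] {k : Type} [Field k] [IsAlgClosed k] [CharP k p]
    {X : Type} [AddCommGroup X] [Module (WittVector p k) X]
    (F0 F1 : Submodule (WittVector p k) X)
    (hpF : ∀ x ∈ F0, (p : WittVector p k) • x ∈ F1) (hfg : F0.FG)
    {q : ℕ} (hq : 2 ≤ q) (τ : WittVector p k →+* WittVector p k)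
    (hτ : ∀ a, (τ a).coeff 0 = a.coeff 0 ^ q)
    (Ψ : X →+ X) (hΨ : ∀ a x, Ψ (a • x) = τ a • Ψ x)
    (hΨ0 : ∀ x, Ψ x ∈ F0 ↔ x ∈ F0) (hΨ1 : ∀ x, Ψ x ∈ F1 ↔ x ∈ F1) (hs : Function.Surjective Ψ) :
    ∃ (m : ℕ) (w : X), w ∈ F0 ∧
      (∀ y ∈ F0, ∃ a : ℕ → WittVector p k, y - ∑ t ∈ Finset.range m, a t • Ψ^[t] w ∈ F1) ∧
      (∀ a : ℕ → WittVector p k, ∑ t ∈ Finset.range m, a t • Ψ^[t] w ∈ F1 →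
        ∀ t < m, (p : WittVector p k) ∣ a t) := by
  classical
  let G := F1.submoduleOf F0
  let V := F0 ⧸ G
  let f : F0 →ₛₗ[τ] F0 :=
    { toFun := fun x => ⟨Ψ x, (hΨ0 x).2 x.2⟩
      map_add' := fun x y => Subtype.ext (by simp)
      map_smul' := fun a x => Subtype.ext (by simp [hΨ]) }
  have hf : G ≤ G.comap f := by
    intro x hx
    exact (hΨ1 _).2 hx
  let Ψ' : V →ₛₗ[τ] V := Submodule.mapQ G G f hf
  have hpV : ∀ x : V, (p : WittVector p k) • x = 0 := by
    intro x
    obtain ⟨x, rfl⟩ := Submodule.Quotient.mk_surjective _ x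
    rw [← Submodule.Quotient.mk_smul, Submodule.Quotient.mk_eq_zero]
    exact hpF x x.2
  have hz : ∀ (a : WittVector p k) (x : V), a.coeff 0 = 0 → a • x = 0 := by
    intro a x ha
    obtain ⟨b, rfl⟩ := witt_p_dvd ha
    rw [mul_comm, mul_smul, hpV, smul_zero]
  let _ : SMul k V := ⟨fun c x => WittVector.teichmuller p c • x⟩
  have hsm : ∀ (a : WittVector p k) (x : V), (WittVector.constantCoeff a : k) • x = a • x := by
    intro a x
    change WittVector.teichmuller p (WittVector.constantCoeff a) • x = a • x
    rw [← sub_eq_zero, ← sub_smul]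
    apply hz
    have : WittVector.constantCoeff (WittVector.teichmuller p (WittVector.constantCoeff a) - a) = (0:k) := by
      rw [map_sub]
      simp [WittVector.constantCoeff, WittVector.teichmuller_coeff_zero]
    exact this
  have hcs : Function.Surjective (WittVector.constantCoeff : WittVector p k →+* k) := fun c =>
    ⟨WittVector.teichmuller p c, WittVector.teichmuller_coeff_zero p c⟩
  let _ : Module k V := Function.Surjective.moduleLeft WittVector.constantCoeff hcs hsm
  have : Module.Finite (WittVector p k) F0 := Module.Finite.iff_fg.2 hfg
  have : Module.Finite k V := by
    obtain ⟨s, hs⟩ := (inferInstance : Module.Finite (WittVector p k) V)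
    refine ⟨s, ?_⟩
    rw [Submodule.eq_top_iff']
    intro x
    have hx : x ∈ Submodule.span (WittVector p k) (s : Set V) := hs ▸ Submodule.mem_top
    induction hx using Submodule.span_induction with
    | mem x h => exact Submodule.subset_span h
    | zero => exact zero_mem _
    | add x y _ _ h1 h2 => exact add_mem h1 h2
    | smul a x _ h => rw [← hsm]; exact Submodule.smul_mem _ _ h
  obtain ⟨v, m, hli, hsp⟩ := exists_cyclic (k := k) hq Ψ'.toAddMonoidHom (by
      intro y
      obtain ⟨y, rfl⟩ := Submodule.Quotient.mk_surjective _ y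
      obtain ⟨x, hx⟩ := hs y
      exact ⟨Submodule.Quotient.mk ⟨x, (hΨ0 x).1 (hx ▸ y.2)⟩,
        congrArg Submodule.Quotient.mk (Subtype.ext hx)⟩) (by
      intro c x
      obtain ⟨a, rfl⟩ := hcs c
      rw [hsm]
      have : (WittVector.constantCoeff a : k) ^ q = WittVector.constantCoeff (τ a) := (hτ a).symm
      rw [this, hsm]
      exact Ψ'.map_smulₛₗ a x)
  obtain ⟨w, rfl⟩ := Submodule.Quotient.mk_surjective _ v
  have hit : ∀ t : ℕ, ∃ h : Ψ^[t] w ∈ F0, Ψ'.toAddMonoidHom^[t] (Submodule.Quotient.mk w) =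
      (Submodule.Quotient.mk ⟨Ψ^[t] w, h⟩ : V) := by
    intro t
    induction t with
    | zero => exact ⟨w.2, rfl⟩
    | succ t ih =>
      obtain ⟨h, e⟩ := ih
      refine ⟨by rw [Function.iterate_succ_apply']; exact (hΨ0 _).2 h, ?_⟩
      rw [Function.iterate_succ_apply', e]
      refine congrArg Submodule.Quotient.mk (Subtype.ext ?_)
      exact (Function.iterate_succ_apply' Ψ t (w : X)).symm
  choose hmem hit using hit
  have key : ∀ (a : ℕ → WittVector p k),
      ∑ t : Fin m, (WittVector.constantCoeff (a t) : k) •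
        Ψ'.toAddMonoidHom^[(t:ℕ)] (Submodule.Quotient.mk w) =
      (Submodule.Quotient.mk (∑ t ∈ Finset.range m, a t • (⟨Ψ^[t] w, hmem t⟩ : F0)) : V) := by
    intro a
    rw [Finset.sum_range]
    refine Eq.trans ?_ (map_sum G.mkQ _ _).symm
    refine Finset.sum_congr rfl fun t _ => ?_
    rw [hsm, hit, map_smul]; rfl
  refine ⟨m, w, w.2, ?_, ?_⟩
  · intro y hy
    have h1 : (Submodule.Quotient.mk ⟨y, hy⟩ : V) ∈ Submodule.span k
      (Set.range fun t : Fin m => Ψ'.toAddMonoidHom^[(t:ℕ)] (Submodule.Quotient.mk w)) := hsp ▸ Submodule.mem_top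
    rw [Submodule.mem_span_range_iff_exists_fun] at h1
    obtain ⟨c, hc⟩ := h1
    have hcs' := hcs
    choose b hb using hcs'
    obtain ⟨a, ha⟩ : ∃ a : ℕ → WittVector p k, ∀ t : Fin m, WittVector.constantCoeff (a t) = c t :=
      ⟨fun t => if h : t < m then b (c ⟨t, h⟩) else 0, fun t => by simp [hb]⟩
    refine ⟨a, ?_⟩
    have := key a
    simp only [ha] at this
    rw [hc, Submodule.Quotient.eq] at this
    have h2 : ((⟨y, hy⟩ - ∑ t ∈ Finset.range m, a t • (⟨Ψ^[t] w, hmem t⟩ : F0) : F0) : X) ∈ F1 := this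
    simpa using h2
  · intro a ha t ht
    have h1 := key a
    have h2 : (Submodule.Quotient.mk (∑ t ∈ Finset.range m, a t • (⟨Ψ^[t] w, hmem t⟩ : F0)) : V) = 0 := by
      rw [Submodule.Quotient.mk_eq_zero]
      change ((∑ t ∈ Finset.range m, a t • (⟨Ψ^[t] w, hmem t⟩ : F0) : F0) : X) ∈ F1
      simpa using ha
    rw [h2] at h1
    exact witt_p_dvd (Fintype.linearIndependent_iff.1 hli _ h1 ⟨t, ht⟩)

section Val
variable {p : ℕ} [Fact p.Prime] {k : Type} [Field k] [IsAlgClosed k] [CharP k p]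

local notation "Wk" => WittVector p k
local notation "Lk" => FractionRing (WittVector p k)

/-- `VG c q` : the `p`-adic valuation of `c` is at least `q`. -/
def VG (c : K(p, k)) (q : ℚ) : Prop :=
  ∃ (m : ℤ) (a : WittVector p k), q ≤ m ∧ c = (p : K(p, k)) ^ m * algebraMap (WittVector p k) (K(p, k)) a

theorem pL_ne : (p : Lk) ≠ 0 := WittVector.FractionRing.p_nonzero p k

theorem VG.mono {c : Lk} {q q' : ℚ} (h : VG c q) (hq : q' ≤ q) : VG c q' := by
  obtain ⟨m, a, h1, h2⟩ := h
  exact ⟨m, a, hq.trans h1, h2⟩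

theorem VG.int {c : Lk} {m : ℤ} (h : VG c (m : ℚ)) : ∃ a : Wk, c = (p : Lk) ^ m * algebraMap Wk Lk a := by
  obtain ⟨m', a, h1, h2⟩ := h
  have h1 : m ≤ m' := by exact_mod_cast h1
  obtain ⟨j, rfl⟩ := Int.le.dest h1
  refine ⟨(p : Wk) ^ j * a, ?_⟩
  rw [h2, zpow_add₀ pL_ne, map_mul, map_pow, map_natCast, zpow_natCast]
  ring

theorem VG.of_int {c : Lk} {m : ℤ} {a : Wk} (h : c = (p : Lk) ^ m * algebraMap Wk Lk a) : VG c (m : ℚ) :=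
  ⟨m, a, le_rfl, h⟩

theorem VG.zero (q : ℚ) : VG (0 : Lk) q := ⟨⌈q⌉, 0, Int.le_ceil q, by simp⟩

theorem VG.one {q : ℚ} (h : q ≤ 0) : VG (1 : Lk) q := ⟨0, 1, by simpa using h, by simp⟩

theorem VG.ceil {c : Lk} {q : ℚ} (h : VG c q) : VG c (⌈q⌉ : ℤ) := by
  obtain ⟨m', a, h1, h2⟩ := h
  exact ⟨m', a, by exact_mod_cast Int.ceil_le.2 h1, h2⟩

theorem VG.add {c d : Lk} {q : ℚ} (h : VG c q) (h' : VG d q) : VG (c + d) q := by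
  obtain ⟨a, ha⟩ := h.ceil.int
  obtain ⟨b, hb⟩ := h'.ceil.int
  exact ⟨⌈q⌉, a + b, Int.le_ceil q, by rw [ha, hb, map_add]; ring⟩

theorem VG.neg {c : Lk} {q : ℚ} (h : VG c q) : VG (-c) q := by
  obtain ⟨m, a, h1, h2⟩ := h
  exact ⟨m, -a, h1, by rw [h2, map_neg]; ring⟩

theorem VG.mul {c d : Lk} {q q' : ℚ} (h : VG c q) (h' : VG d q') : VG (c * d) (q + q') := by
  obtain ⟨m, a, h1, h2⟩ := h
  obtain ⟨m', a', h1', h2'⟩ := h'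
  exact ⟨m + m', a * a', by push_cast; linarith, by
    rw [h2, h2', zpow_add₀ pL_ne, map_mul]; ring⟩

theorem VG.sum {ι : Type} {s : Finset ι} {f : ι → Lk} {q : ℚ} (h : ∀ i ∈ s, VG (f i) q) :
    VG (∑ i ∈ s, f i) q := by
  classical
  induction s using Finset.induction_on with
  | empty => exact VG.zero q
  | insert a s ha ih =>
    rw [Finset.sum_insert ha]
    exact (h a (by simp)).add (ih fun i hi => h i (by simp [hi]))

theorem exists_unit {c : Lk} (hc : c ≠ 0) : ∃ (h : ℤ) (u : Wkˣ), c = (p : Lk) ^ h * algebraMap Wk Lk u := by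
  obtain ⟨a, b, hb, rfl⟩ := IsFractionRing.div_surjective (A := Wk) c
  have hb0 : b ≠ 0 := nonZeroDivisors.ne_zero hb
  have ha0 : a ≠ 0 := by rintro rfl; simp at hc
  obtain ⟨m, u, rfl⟩ := WittVector.exists_eq_pow_p_mul' a ha0
  obtain ⟨m', u', rfl⟩ := WittVector.exists_eq_pow_p_mul' b hb0
  refine ⟨m - m', u * u'⁻¹, ?_⟩
  have h1 : algebraMap Wk Lk u' ≠ 0 := by simp
  have h2 : algebraMap Wk Lk (u'⁻¹ : Wkˣ) * algebraMap Wk Lk u' = 1 := by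
    rw [← map_mul]; simp
  rw [zpow_sub₀ pL_ne]
  simp only [map_mul, map_pow, map_natCast, zpow_natCast, Units.val_mul]
  rw [eq_inv_of_mul_eq_one_left h2]
  have := pL_ne (p := p) (k := k)
  field_simp

theorem exists_VG (c : Lk) : ∃ m : ℤ, VG c m := by
  by_cases hc : c = 0
  · exact ⟨0, hc ▸ VG.zero _⟩
  obtain ⟨h, u, e⟩ := exists_unit hc
  exact ⟨h, .of_int e⟩

theorem not_VG_unit {c : Lk} {h : ℤ} {u : Wkˣ} (hc : c = (p : Lk) ^ h * algebraMap Wk Lk u) {q : ℚ}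
    (hq : VG c q) : q ≤ h := by
  by_contra! hlt
  have h1 : VG c ((h + 1 : ℤ) : ℚ) := by
    obtain ⟨m, a, h1, h2⟩ := hq
    refine VG.mono (.of_int h2) ?_
    have : (h : ℚ) < m := by linarith
    exact_mod_cast this
  obtain ⟨a, ha⟩ := h1.int
  have h0 : (p : Lk) ^ h ≠ 0 := zpow_ne_zero _ pL_ne
  rw [hc, zpow_add₀ pL_ne, zpow_one, mul_assoc] at ha
  have h2 := mul_left_cancel₀ h0 ha
  have h3 : (u : Wk) = p * a := by
    apply IsFractionRing.injective Wk Lk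
    rw [h2, map_mul, map_natCast]
  exact (WittVector.irreducible p (k := k)).not_isUnit (isUnit_of_mul_isUnit_left (h3 ▸ u.isUnit))

theorem eq_zero_of_VG {c : Lk} (h : ∀ m : ℤ, VG c m) : c = 0 := by
  by_contra hc
  obtain ⟨h', u, e⟩ := exists_unit hc
  have := not_VG_unit e (h (h' + 1))
  push_cast at this
  linarith

theorem VG_or {c : Lk} (q : ℚ) : (∃ m : ℤ, q < m ∧ VG c m) ∨ VG c⁻¹ (-q) := by
  by_cases hc : c = 0
  · left; exact ⟨⌊q⌋ + 1, by push_cast; exact Int.lt_floor_add_one q, hc ▸ VG.zero _⟩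
  obtain ⟨h, u, e⟩ := exists_unit hc
  rcases lt_or_ge q h with h1 | h1
  · left; exact ⟨h, h1, .of_int e⟩
  · right
    refine ⟨-h, (u⁻¹ : Wkˣ), by push_cast; linarith, ?_⟩
    have h2 : algebraMap Wk Lk (u⁻¹ : Wkˣ) * algebraMap Wk Lk u = 1 := by
      rw [← map_mul]; simp
    rw [e, mul_inv, zpow_neg, eq_inv_of_mul_eq_one_left h2]

theorem frobL_algebraMap (a : Wk) :
    frobL p k (algebraMap Wk Lk a) = algebraMap Wk Lk (WittVector.frobeniusEquiv p k a) :=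
  IsFractionRing.ringEquivOfRingEquiv_algebraMap _ _

theorem frobL_pow_algebraMap (i : ℕ) (a : Wk) :
    (frobL p k ^ i : RingAut Lk) (algebraMap Wk Lk a) =
      algebraMap Wk Lk ((WittVector.frobeniusEquiv p k ^ i : RingAut Wk) a) := by
  induction i generalizing a with
  | zero => simp
  | succ i ih => rw [pow_succ, pow_succ, RingAut.mul_apply, RingAut.mul_apply, frobL_algebraMap, ih]

theorem frobL_pow_p (i : ℕ) (m : ℤ) : (frobL p k ^ i : RingAut Lk) ((p : Lk) ^ m) = (p : Lk) ^ m := by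
  rw [map_zpow₀, map_natCast]

theorem VG.frob {c : Lk} {q : ℚ} (h : VG c q) (i : ℕ) : VG ((frobL p k ^ i : RingAut Lk) c) q := by
  obtain ⟨m, a, h1, h2⟩ := h
  exact ⟨m, _, h1, by rw [h2, map_mul, frobL_pow_p, frobL_pow_algebraMap]⟩

theorem frobW_coeff (i : ℕ) (a : Wk) :
    ((WittVector.frobeniusEquiv p k ^ i : RingAut Wk) a).coeff 0 = a.coeff 0 ^ (p ^ i) := by
  induction i generalizing a with
  | zero => simp
  | succ i ih =>
    rw [pow_succ, RingAut.mul_apply, ih, WittVector.frobeniusEquiv_apply,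
      WittVector.coeff_frobenius_charP, ← pow_mul, pow_succ, mul_comm]

end Val

section Iso
variable {p : ℕ} [Fact p.Prime] {k : Type} [Field k] [IsAlgClosed k] [CharP k p]
variable {X : Type} [AddCommGroup X] [Module (K(p, k)) X] [Module (WittVector p k) X]
  [IsScalarTower (WittVector p k) (K(p, k)) X]

local notation "Wk" => WittVector p k
local notation "Lk" => FractionRing (WittVector p k)

theorem End_mul_apply {Y : Type} [AddCommGroup Y] (f g : AddMonoid.End Y) (x : Y) :
    (f * g) x = f (g x) := rfl

/-- `Φ` is a `σ`-linear bijection. -/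
structure IsSL (Φ : AddMonoid.End X) : Prop where
  smul : ∀ (c : K(p, k)) (x : X), Φ (c • x) = frobL p k c • Φ x
  bij : Function.Bijective Φ

theorem IsSL.pow_smul {Φ : AddMonoid.End X} (h : IsSL (p := p) (k := k) Φ) (i : ℕ) (c : Lk) (x : X) :
    (Φ ^ i) (c • x) = (frobL p k ^ i : RingAut Lk) c • (Φ ^ i) x := by
  induction i generalizing c x with
  | zero => simp
  | succ i ih =>
    rw [pow_succ, pow_succ, End_mul_apply, End_mul_apply, h.smul, ih,
      RingAut.mul_apply]

theorem IsSL.pow_smulW {Φ : AddMonoid.End X} (h : IsSL (p := p) (k := k) Φ) (i : ℕ) (c : Wk) (x : X) :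
    (Φ ^ i) (c • x) = (WittVector.frobeniusEquiv p k ^ i : RingAut Wk) c • (Φ ^ i) x := by
  rw [← algebraMap_smul Lk c x, h.pow_smul, frobL_pow_algebraMap, algebraMap_smul]

theorem IsSL.pow_smul_p {Φ : AddMonoid.End X} (h : IsSL (p := p) (k := k) Φ) (i : ℕ) (m : ℤ) (x : X) :
    (Φ ^ i) ((p : Lk) ^ m • x) = (p : Lk) ^ m • (Φ ^ i) x := by
  rw [h.pow_smul, frobL_pow_p]

theorem IsSL.pow_bij {Φ : AddMonoid.End X} (h : IsSL (p := p) (k := k) Φ) (i : ℕ) :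
    Function.Bijective (Φ ^ i) := by
  rw [AddMonoid.End.coe_pow]
  exact h.bij.iterate i

/-- A filtration adapted to an isoclinic isocrystal `P` of slope `s / r`. -/
structure FilData (Φ : AddMonoid.End X) (r : ℕ) (s : ℤ) (P : Submodule (K(p, k)) X) where
  Fil : ℤ → Submodule (WittVector p k) X
  anti : ∀ l, Fil (l + 1) ≤ Fil l
  phi : ∀ l x, Φ x ∈ Fil (l + s) ↔ x ∈ Fil l
  pp : ∀ l x, (p : K(p, k)) • x ∈ Fil (l + r) ↔ x ∈ Fil l
  fg : ∀ l, (Fil l).FG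
  sp : ∀ l, Submodule.span (K(p, k)) (Fil l : Set X) = P

namespace FilData
variable {Φ : AddMonoid.End X} {r : ℕ} {s : ℤ} {P : Submodule (K(p, k)) X}

/-- Shift of a filtration. -/
def shift (D : FilData Φ r s P) (e : ℤ) : FilData Φ r s P where
  Fil l := D.Fil (l + e)
  anti l := by have := D.anti (l + e); rwa [add_right_comm] at this
  phi l x := by rw [add_right_comm]; exact D.phi _ x
  pp l x := by rw [add_right_comm]; exact D.pp _ x
  fg l := D.fg _
  sp l := D.sp _

theorem anti' (D : FilData Φ r s P) {l l' : ℤ} (h : l ≤ l') : D.Fil l' ≤ D.Fil l := by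
  induction l', h using Int.leInduction with
  | base => exact le_rfl
  | succ n _ ih => exact (D.anti n).trans ih

theorem phi_pow (D : FilData Φ r s P) (i : ℕ) (l : ℤ) (x : X) :
    (Φ ^ i) x ∈ D.Fil (l + i * s) ↔ x ∈ D.Fil l := by
  induction i generalizing x l with
  | zero => simp
  | succ i ih =>
    rw [pow_succ, End_mul_apply, ← D.phi l x, ← ih (l + s)]
    have : l + ((i + 1 : ℕ) : ℤ) * s = l + s + i * s := by push_cast; ring
    rw [this]

theorem pp_nat (D : FilData Φ r s P) (b : ℕ) (l : ℤ) (x : X) :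
    (p : Lk) ^ b • x ∈ D.Fil (l + b * r) ↔ x ∈ D.Fil l := by
  induction b generalizing x l with
  | zero => simp
  | succ i ih =>
    rw [pow_succ, mul_smul, ← D.pp l x, ← ih (l + r)]
    have : l + ((i + 1 : ℕ) : ℤ) * r = l + r + i * r := by push_cast; ring
    rw [this]

theorem pp_zpow (D : FilData Φ r s P) (b : ℤ) (l : ℤ) (x : X) :
    (p : Lk) ^ b • x ∈ D.Fil (l + b * r) ↔ x ∈ D.Fil l := by
  obtain ⟨j, rfl | rfl⟩ := b.eq_nat_or_neg
  · rw [zpow_natCast]; exact D.pp_nat j l x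
  · rw [← D.pp_nat j (l + -(j : ℤ) * r), zpow_neg, zpow_natCast, smul_inv_smul₀ (pow_ne_zero _ pL_ne)]
    have : l + -(j : ℤ) * r + j * r = l := by ring
    rw [this]

theorem VG_smul (D : FilData Φ r s P) {c : Lk} {m l l' : ℤ} (hc : VG c m) {x : X} (hx : x ∈ D.Fil l)
    (hl : l' ≤ l + m * r) : c • x ∈ D.Fil l' := by
  obtain ⟨a, rfl⟩ := hc.int
  refine D.anti' hl ?_
  rw [mul_smul, D.pp_zpow, algebraMap_smul]
  exact Submodule.smul_mem _ _ hx

theorem exists_rep (hr : 0 < r) (hcop : IsCoprime s (r : ℤ)) (l : ℤ) :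
    ∃ i : ℕ, i < r ∧ ∃ b : ℤ, i * s + b * r = l := by
  obtain ⟨u, v, huv⟩ := hcop
  have hr' : (r : ℤ) ≠ 0 := by omega
  refine ⟨((l * u) % r).toNat, ?_, l * v + (l * u) / r * s, ?_⟩
  · have := Int.emod_lt_of_pos (l * u) (by omega : (0:ℤ) < r)
    omega
  · rw [Int.toNat_of_nonneg (Int.emod_nonneg _ hr')]
    have h1 := Int.emod_add_mul_ediv (l * u) r
    have h2 : (l * u) % r = l * u - r * (l * u / r) := by linarith
    rw [h2]
    linear_combination l * huv

theorem rep_unique (hcop : IsCoprime s (r : ℤ)) {i j : ℕ} {l : ℤ} (hi : i < r)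
    {b b' : ℤ} (h : i * s + b * r = l) (h' : j * s + b' * r = l) : j % r = i := by
  have h1 : (r : ℤ) ∣ s * (j - i) := ⟨b - b', by linear_combination h' - h⟩
  have h2 : (r : ℤ) ∣ (j : ℤ) - i := hcop.symm.dvd_of_dvd_mul_left h1
  have h3 : i ≡ j [MOD r] := (Nat.modEq_iff_dvd).2 h2
  rw [← Nat.mod_eq_of_lt hi]
  exact h3.symm

theorem orth (D : FilData Φ r s P) (hΦ : IsSL (p := p) (k := k) Φ) (hr : 0 < r)
    (hcop : IsCoprime s (r : ℤ)) {w : X}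
    (hw : w ∈ D.Fil 0) {m : ℕ}
    (hind : ∀ a : ℕ → Wk, ∑ t ∈ Finset.range m, a t • ((p : Lk) ^ (-(s * t)) • (Φ ^ (r * t)) w) ∈ D.Fil 1 →
      ∀ t < m, (p : Wk) ∣ a t)
    (l : ℤ) (c : ℕ → Lk) (hc : ∑ i ∈ Finset.range (r * m), c i • (Φ ^ i) w ∈ D.Fil l) :
    ∀ i < r * m, VG (c i) (((l - i * s : ℤ) : ℚ) / r) := by
  have hrq : (0 : ℚ) < r := by exact_mod_cast hr
  -- starting point
  obtain ⟨l0, hl0, hb0⟩ : ∃ l0 ≤ l, ∀ i < r * m, VG (c i) (((l0 - i * s : ℤ) : ℚ) / r) := by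
    choose M hM using fun i => exists_VG (c i)
    obtain ⟨B, hB⟩ : ∃ B : ℤ, ∀ i ∈ Finset.range (r * m), B ≤ M i * r + i * s := by
      obtain ⟨B, hB⟩ := ((Finset.range (r * m)).image fun i : ℕ => M i * r + i * s).bddBelow
      exact ⟨B, fun i hi => hB (by simpa using ⟨i, by simpa using hi, rfl⟩)⟩
    refine ⟨min B l, min_le_right _ _, fun i hi => (hM i).mono ?_⟩
    rw [div_le_iff₀ hrq]
    have := hB i (by simpa using hi)
    have h2 : min B l ≤ B := min_le_left _ _
    have : min B l - i * s ≤ M i * r := by linarith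
    exact_mod_cast this
  induction l, hl0 using Int.leInduction with
  | base => exact hb0
  | succ l' hl' ih =>
    have hb := ih (D.anti _ hc)
    obtain ⟨i0, hi0, b, hib⟩ := exists_rep hr hcop l'
    have hgood : ∀ i < r * m, i % r ≠ i0 → VG (c i) (((l' + 1 - i * s : ℤ) : ℚ) / r) := by
      intro i hi hne
      obtain ⟨M, a, h1, h2⟩ := hb i hi
      refine (VG.of_int h2).mono ?_
      rw [div_le_iff₀ hrq] at h1 ⊢
      have h1 : l' - i * s ≤ M * r := by exact_mod_cast h1
      have h3 : l' - i * s ≠ M * r := fun e => hne (rep_unique (b' := M) hcop hi0 hib (by linarith))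
      have : l' + 1 - i * s ≤ M * r := by omega
      exact_mod_cast this
    have hrest : ∑ i ∈ Finset.range (r * m) with ¬ (i % r = i0), c i • (Φ ^ i) w ∈ D.Fil (l' + 1) := by
      refine Submodule.sum_mem _ fun i hi => ?_
      simp only [Finset.mem_filter, Finset.mem_range] at hi
      refine D.VG_smul (hgood i hi.1 hi.2).ceil ((D.phi_pow i 0 w).2 hw) ?_
      have h1 := Int.le_ceil (((l' + 1 - i * s : ℤ) : ℚ) / r)
      rw [div_le_iff₀ hrq] at h1
      have h1 : l' + 1 - i * s ≤ ⌈((l' + 1 - i * s : ℤ) : ℚ) / r⌉ * r := by exact_mod_cast h1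
      linarith
    have hmain : ∑ t ∈ Finset.range m, c (i0 + r * t) • (Φ ^ (i0 + r * t)) w ∈ D.Fil (l' + 1) := by
      have h1 : ∑ i ∈ Finset.range (r * m) with (i % r = i0), c i • (Φ ^ i) w ∈ D.Fil (l' + 1) := by
        have := Finset.sum_filter_add_sum_filter_not (Finset.range (r * m)) (fun i => i % r = i0)
          (fun i => c i • (Φ ^ i) w)
        rw [← this] at hc
        exact (Submodule.add_mem_iff_left _ hrest).1 hc
      convert h1 using 1
      refine Finset.sum_nbij' (fun t => i0 + r * t) (fun i => i / r) ?_ ?_ ?_ ?_ ?_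
      · intro t ht
        simp only [Finset.mem_filter, Finset.mem_range] at ht ⊢
        refine ⟨?_, by rw [Nat.add_mul_mod_self_left, Nat.mod_eq_of_lt hi0]⟩
        calc i0 + r * t < r + r * t := by omega
          _ = r * (t + 1) := by ring
          _ ≤ r * m := Nat.mul_le_mul_left _ ht
      · intro i hi
        simp only [Finset.mem_filter, Finset.mem_range] at hi ⊢
        exact Nat.div_lt_of_lt_mul hi.1
      · intro t ht
        change (i0 + r * t) / r = t
        rw [Nat.add_mul_div_left _ _ hr, Nat.div_eq_of_lt hi0, zero_add]
      · intro i hi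
        simp only [Finset.mem_filter, Finset.mem_range] at hi ⊢
        rw [← hi.2]; exact Nat.mod_add_div i r
      · intro t ht; rfl
    have hlt : ∀ t < m, i0 + r * t < r * m := by
      intro t ht
      calc i0 + r * t < r + r * t := by omega
          _ = r * (t + 1) := by ring
          _ ≤ r * m := Nat.mul_le_mul_left _ ht
    have hex : ∀ t : ℕ, ∃ a : Wk, t < m → c (i0 + r * t) = (p : Lk) ^ (b - s * t) * algebraMap Wk Lk
        ((WittVector.frobeniusEquiv p k ^ i0 : RingAut Wk) a) := by
      intro t
      by_cases ht : t < m
      · have h1 := hb _ (hlt t ht)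
        have e : (((l' - ((i0 + r * t : ℕ) : ℤ) * s : ℤ) : ℚ) / r) = ((b - s * t : ℤ) : ℚ) := by
          rw [div_eq_iff hrq.ne', ← hib]; push_cast; ring
        rw [e] at h1
        obtain ⟨a, ha⟩ := h1.int
        exact ⟨(WittVector.frobeniusEquiv p k ^ i0 : RingAut Wk).symm a, fun _ => by
          rw [RingEquiv.apply_symm_apply]; exact ha⟩
      · exact ⟨0, fun h => absurd h ht⟩
    choose a ha using hex
    have heq : ∑ t ∈ Finset.range m, c (i0 + r * t) • (Φ ^ (i0 + r * t)) w =
        (p : Lk) ^ b • (Φ ^ i0) (∑ t ∈ Finset.range m, a t • ((p : Lk) ^ (-(s * t)) • (Φ ^ (r * t)) w)) := by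
      rw [map_sum, Finset.smul_sum]
      refine Finset.sum_congr rfl fun t ht => ?_
      rw [hΦ.pow_smulW, hΦ.pow_smul_p, ← End_mul_apply, ← pow_add,
        ← algebraMap_smul Lk ((WittVector.frobeniusEquiv p k ^ i0 : RingAut Wk) (a t)),
        smul_smul, smul_smul, ha t (by simpa using ht), sub_eq_add_neg, zpow_add₀ pL_ne]
      congr 1; ring
    rw [heq, ← hib, show (i0 : ℤ) * s + b * r + 1 = 1 + i0 * s + b * r by ring, D.pp_zpow, D.phi_pow] at hmain
    have hdvd := hind a hmain
    intro i hi
    by_cases hii : i % r = i0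
    · have hti : i = i0 + r * (i / r) := by rw [← hii]; exact (Nat.mod_add_div i r).symm
      have htm : i / r < m := Nat.div_lt_of_lt_mul hi
      generalize i / r = t at hti htm
      subst hti
      obtain ⟨e, he⟩ := hdvd t htm
      have h1 : VG (c (i0 + r * t)) ((b - s * t + 1 : ℤ) : ℚ) := by
        refine VG.of_int (a := (WittVector.frobeniusEquiv p k ^ i0 : RingAut Wk) e) ?_
        rw [ha t htm, he, map_mul, map_natCast, map_mul, map_natCast, zpow_add₀ pL_ne, zpow_one]; ring
      refine h1.mono ?_
      rw [div_le_iff₀ hrq, ← hib]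
      push_cast
      have : (1 : ℚ) ≤ r := by exact_mod_cast hr
      nlinarith
    · exact hgood i hi hii

end FilData
end Iso

section IsoTwo
variable {p : ℕ} [Fact p.Prime] {k : Type} [Field k] [IsAlgClosed k] [CharP k p]
variable {X : Type} [AddCommGroup X] [Module (K(p, k)) X] [Module (WittVector p k) X]
  [IsScalarTower (WittVector p k) (K(p, k)) X]

local notation "Wk" => WittVector p k
local notation "Lk" => FractionRing (WittVector p k)

namespace FilData
variable {Φ : AddMonoid.End X} {r : ℕ} {s : ℤ} {P : Submodule (K(p, k)) X}

theorem twist_mem (D : FilData Φ r s P) (t : ℕ) (l : ℤ) (x : X) :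
    (p : Lk) ^ (-(s * t)) • (Φ ^ (r * t)) x ∈ D.Fil l ↔ x ∈ D.Fil l := by
  rw [← D.phi_pow (r * t) l x, ← D.pp_zpow (-(s * t)) (l + ((r * t : ℕ) : ℤ) * s)]
  have : l + ((r * t : ℕ) : ℤ) * s + -(s * t) * r = l := by push_cast; ring
  rw [this]

theorem cyclic_pre (D : FilData Φ r s P) (hΦ : IsSL (p := p) (k := k) Φ) (hr : 0 < r) :
    ∃ (m : ℕ) (w0 : X), w0 ∈ D.Fil 0 ∧ ∀ w, w - w0 ∈ D.Fil 1 → w ∈ D.Fil 0 ∧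
      (∀ y ∈ D.Fil 0, ∃ a : ℕ → Wk,
        y - ∑ t ∈ Finset.range m, a t • ((p : Lk) ^ (-(s * t)) • (Φ ^ (r * t)) w) ∈ D.Fil 1) ∧
      (∀ a : ℕ → Wk,
        ∑ t ∈ Finset.range m, a t • ((p : Lk) ^ (-(s * t)) • (Φ ^ (r * t)) w) ∈ D.Fil 1 →
        ∀ t < m, (p : Wk) ∣ a t) := by
  let Ψ : X →+ X :=
    { toFun := fun x => (p : Lk) ^ (-s) • (Φ ^ r) x
      map_zero' := by simp
      map_add' := fun x y => by simp }
  have hΨd : ∀ x, Ψ x = (p : Lk) ^ (-s) • (Φ ^ r) x := fun x => rfl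
  have hit : ∀ (t : ℕ) (x : X), Ψ^[t] x = (p : Lk) ^ (-(s * t)) • (Φ ^ (r * t)) x := by
    intro t
    induction t with
    | zero => intro x; simp
    | succ t ih =>
      intro x
      rw [Function.iterate_succ_apply', ih, hΨd, hΦ.pow_smul_p, smul_smul, ← zpow_add₀ pL_ne,
        ← End_mul_apply, ← pow_add]
      congr 2
      · push_cast; ring_nf
      · congr 1; ring
  have hmem : ∀ l x, Ψ x ∈ D.Fil l ↔ x ∈ D.Fil l := by
    intro l x
    have := D.twist_mem 1 l x
    simpa [hΨd] using this
  obtain ⟨m, w0, h0, hgen, hind⟩ := exists_cyclic_witt (D.Fil 0) (D.Fil 1)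
    (fun x hx => by
      have h1 := (D.pp 0 x).2 hx
      have h2 := D.anti' (show (1 : ℤ) ≤ 0 + r by omega) h1
      have h3 : (p : Wk) • x = (p : Lk) • x := by
        rw [← algebraMap_smul Lk (p : Wk) x, map_natCast]
      rw [h3]; exact h2)
    (D.fg 0) (q := p ^ r)
    (le_trans (Fact.out : p.Prime).two_le (Nat.le_self_pow hr.ne' p))
    ((WittVector.frobeniusEquiv p k ^ r : RingAut Wk) : Wk →+* Wk)
    (fun a => frobW_coeff r a) Ψ
    (fun a x => by
      rw [hΨd, hΨd, hΦ.pow_smulW, smul_comm]; rfl)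
    (hmem 0) (hmem 1)
    (fun y => by
      obtain ⟨x, hx⟩ := (hΦ.pow_bij r).2 ((p : Lk) ^ s • y)
      exact ⟨x, by rw [hΨd, hx, smul_smul, ← zpow_add₀ pL_ne]; simp⟩)
  simp only [hit] at hgen hind
  refine ⟨m, w0, h0, fun w hw => ?_⟩
  have hd : ∀ a : ℕ → Wk,
      ∑ t ∈ Finset.range m, a t • ((p : Lk) ^ (-(s * t)) • (Φ ^ (r * t)) w) -
      ∑ t ∈ Finset.range m, a t • ((p : Lk) ^ (-(s * t)) • (Φ ^ (r * t)) w0) ∈ D.Fil 1 := by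
    intro a
    rw [← Finset.sum_sub_distrib]
    refine Submodule.sum_mem _ fun t _ => ?_
    rw [← smul_sub, ← smul_sub, ← map_sub]
    exact Submodule.smul_mem _ _ ((D.twist_mem t 1 _).2 hw)
  refine ⟨?_, ?_, ?_⟩
  · have := Submodule.add_mem _ (D.anti 0 hw) h0
    simpa using this
  · intro y hy
    obtain ⟨a, ha⟩ := hgen y hy
    refine ⟨a, ?_⟩
    have := Submodule.sub_mem _ ha (hd a)
    rwa [sub_sub_sub_cancel_right] at this
    
  · intro a ha
    refine hind a ?_
    have := Submodule.sub_mem _ ha (hd a)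
    rwa [sub_sub_cancel] at this

theorem span_le (D : FilData Φ r s P) (hΦ : IsSL (p := p) (k := k) Φ) (hr : 0 < r)
    (hcop : IsCoprime s (r : ℤ)) {w : X} {m : ℕ}
    (hgen : ∀ y ∈ D.Fil 0, ∃ a : ℕ → Wk,
        y - ∑ t ∈ Finset.range m, a t • ((p : Lk) ^ (-(s * t)) • (Φ ^ (r * t)) w) ∈ D.Fil 1) :
    P ≤ Submodule.span Lk (Set.range fun i : Fin (r * m) => (Φ ^ (i : ℕ)) w) := by
  set V := Submodule.span Lk (Set.range fun i : Fin (r * m) => (Φ ^ (i : ℕ)) w) with hV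
  let U : Submodule Wk X := V.restrictScalars Wk
  have hU : ∀ x, x ∈ U ↔ x ∈ V := fun x => Iff.rfl
  have step : ∀ l : ℤ, D.Fil l ≤ U ⊔ D.Fil (l + 1) := by
    intro l x hx
    obtain ⟨i0, hi0, b, hib⟩ := exists_rep hr hcop l
    obtain ⟨y, hy⟩ := (hΦ.pow_bij i0).2 ((p : Lk) ^ (-b) • x)
    have hx' : x = (p : Lk) ^ b • (Φ ^ i0) y := by
      rw [hy, smul_smul, ← zpow_add₀ pL_ne]; simp
    have hy0 : y ∈ D.Fil 0 := by
      rw [← D.phi_pow i0, ← D.pp_zpow b, ← hx', zero_add, hib]; exact hx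
    obtain ⟨a, ha⟩ := hgen y hy0
    set z := ∑ t ∈ Finset.range m, a t • ((p : Lk) ^ (-(s * t)) • (Φ ^ (r * t)) w) with hz
    have hsplit : x = (p : Lk) ^ b • (Φ ^ i0) z + (p : Lk) ^ b • (Φ ^ i0) (y - z) := by
      rw [← smul_add, ← map_add, add_sub_cancel, hx']
    rw [hsplit]
    refine Submodule.add_mem_sup ?_ ?_
    · rw [hU]
      refine Submodule.smul_mem _ _ ?_
      rw [hz, map_sum]
      refine Submodule.sum_mem _ fun t ht => ?_
      have ht : t < m := by simpa using ht
      rw [hΦ.pow_smulW, hΦ.pow_smul_p, ← End_mul_apply, ← pow_add, ← algebraMap_smul Lk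
        ((WittVector.frobeniusEquiv p k ^ i0 : RingAut Wk) (a t))]
      refine Submodule.smul_mem _ _ (Submodule.smul_mem _ _ (Submodule.subset_span ?_))
      refine ⟨⟨i0 + r * t, ?_⟩, rfl⟩
      calc i0 + r * t < r + r * t := by omega
          _ = r * (t + 1) := by ring
          _ ≤ r * m := Nat.mul_le_mul_left _ ht
    · have : l + 1 = 1 + i0 * s + b * r := by linarith
      rw [this, D.pp_zpow, D.phi_pow]
      exact ha
  have step2 : ∀ l : ℕ, D.Fil 0 ≤ U ⊔ D.Fil l := by
    intro l
    induction l with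
    | zero => exact le_sup_right
    | succ l ih =>
      refine ih.trans (sup_le le_sup_left ?_)
      push_cast
      exact step l
  have hp : D.Fil 0 ≤ U ⊔ (Ideal.span {(p : Wk)}) • D.Fil 0 := by
    refine (step2 r).trans (sup_le_sup_left ?_ _)
    intro x hx
    have h1 : (p : Lk)⁻¹ • x ∈ D.Fil 0 := by
      rw [← D.pp, smul_inv_smul₀ pL_ne, zero_add]; exact hx
    have h2 : x = (p : Wk) • ((p : Lk)⁻¹ • x) := by
      rw [← algebraMap_smul Lk (p : Wk), map_natCast, smul_inv_smul₀ pL_ne]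
    rw [h2]
    exact Submodule.smul_mem_smul (Ideal.mem_span_singleton_self _) h1
  have hjac : Ideal.span {(p : Wk)} ≤ Ideal.jacobson ⊥ := by
    rw [IsLocalRing.jacobson_eq_maximalIdeal _ bot_ne_top, Ideal.span_singleton_le_iff_mem,
      IsLocalRing.mem_maximalIdeal]
    exact (WittVector.irreducible p).not_isUnit
  have hle := Submodule.le_of_le_smul_of_le_jacobson_bot (D.fg 0) hjac hp
  rw [← D.sp 0, Submodule.span_le]
  exact fun x hx => hle hx

/-- Strongly cyclic vectors in an isoclinic isocrystal. -/
theorem cyclic (D : FilData Φ r s P) (hΦ : IsSL (p := p) (k := k) Φ) (hr : 0 < r)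
    (hcop : IsCoprime s (r : ℤ)) :
    ∃ w0 ∈ D.Fil 0, ∀ w, w - w0 ∈ D.Fil 1 → ∃ c : ℕ → Lk,
      c (Module.finrank Lk P) = 1 ∧
      ∑ i ∈ Finset.range (Module.finrank Lk P + 1), c i • (Φ ^ i) w = 0 ∧
      P ≤ Submodule.span Lk (Set.range fun i : Fin (Module.finrank Lk P) => (Φ ^ (i : ℕ)) w) ∧
      (∀ i ≤ Module.finrank Lk P,
        VG (c i) (((Module.finrank Lk P : ℚ) - i) * ((s : ℚ) / r))) ∧
      VG (c 0)⁻¹ (-((Module.finrank Lk P : ℚ) * ((s : ℚ) / r))) := by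
  have hrq : (0 : ℚ) < r := by exact_mod_cast hr
  obtain ⟨m, w0, hw0, H⟩ := D.cyclic_pre hΦ hr
  refine ⟨w0, hw0, fun w hw => ?_⟩
  obtain ⟨hwF, hgen, hind⟩ := H w hw
  have horth := D.orth hΦ hr hcop hwF hind
  have hspan := D.span_le hΦ hr hcop hgen
  have hFP : ∀ l, ∀ x ∈ D.Fil l, x ∈ P := fun l x hx => by
    rw [← D.sp l]; exact Submodule.subset_span hx
  have hpow : ∀ i : ℕ, (Φ ^ i) w ∈ D.Fil (i * s) := fun i => by
    have := (D.phi_pow i 0 w).2 hwF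
    rwa [zero_add] at this
  have hspan' : P = Submodule.span Lk (Set.range fun i : Fin (r * m) => (Φ ^ (i : ℕ)) w) := by
    refine le_antisymm hspan (Submodule.span_le.2 ?_)
    rintro _ ⟨i, rfl⟩
    exact hFP _ _ (hpow i)
  have hli : LinearIndependent Lk (fun i : Fin (r * m) => (Φ ^ (i : ℕ)) w) := by
    rw [Fintype.linearIndependent_iff]
    intro g hg i
    let c : ℕ → Lk := fun j => if h : j < r * m then g ⟨j, h⟩ else 0
    have hsum : ∑ j ∈ Finset.range (r * m), c j • (Φ ^ j) w = 0 := by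
      rw [Finset.sum_range, ← hg]
      refine Finset.sum_congr rfl fun j _ => ?_
      simp [c]
    have hgi : g i = c i := by simp [c]
    rw [hgi]
    refine eq_zero_of_VG fun M => ?_
    have := horth (M * r + i * s) c (by rw [hsum]; exact Submodule.zero_mem _) i i.2
    refine this.mono ?_
    rw [le_div_iff₀ hrq]; push_cast; linarith
  have hd : Module.finrank Lk P = r * m := by
    rw [hspan', finrank_span_eq_card hli, Fintype.card_fin]
  rw [hd]
  set d := r * m with hdd
  have hdmem : (Φ ^ d) w ∈ Submodule.span Lk (Set.range fun i : Fin d => (Φ ^ (i : ℕ)) w) := by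
    rw [← hspan']; exact hFP _ _ (hpow d)
  rw [Submodule.mem_span_range_iff_exists_fun] at hdmem
  obtain ⟨g, hg⟩ := hdmem
  let c : ℕ → Lk := fun j => if h : j < d then - g ⟨j, h⟩ else 1
  have hcd : c d = 1 := by simp [c]
  have hsum' : ∑ j ∈ Finset.range d, c j • (Φ ^ j) w = - (Φ ^ d) w := by
    rw [Finset.sum_range, ← hg, ← Finset.sum_neg_distrib]
    refine Finset.sum_congr rfl fun j _ => ?_
    simp [c]
  have hsum : ∑ j ∈ Finset.range (d + 1), c j • (Φ ^ j) w = 0 := by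
    rw [Finset.sum_range_succ, hsum', hcd, one_smul, neg_add_cancel]
  have hbd : ∀ i ≤ d, VG (c i) (((d : ℚ) - i) * ((s : ℚ) / r)) := by
    intro i hi
    rcases hi.lt_or_eq with hi | rfl
    · have := horth (d * s) c (by rw [hsum']; exact Submodule.neg_mem _ (hpow d)) i hi
      refine this.mono (le_of_eq ?_)
      push_cast; ring
    · rw [hcd]; exact VG.one (by simp)
  refine ⟨c, hcd, hsum, hspan, hbd, ?_⟩
  rcases Nat.eq_zero_or_pos d with hd0 | hdpos
  · rw [hd0] at hcd ⊢
    rw [hcd, inv_one]; exact VG.one (by simp)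
  rcases VG_or (c := c 0) ((d : ℚ) * ((s : ℚ) / r)) with ⟨M, hM, hVG⟩ | h
  swap
  · exact h
  exfalso
  have hM' : (d : ℤ) * s + 1 ≤ M * r := by
    rw [← mul_div_assoc, div_lt_iff₀ hrq] at hM
    have : (d : ℤ) * s < M * r := by exact_mod_cast hM
    omega
  have hc0 : c 0 • w ∈ D.Fil (d * s + 1) := D.VG_smul hVG hwF (by linarith)
  obtain ⟨e, he⟩ : ∃ e, d = e + 1 := ⟨d - 1, by omega⟩
  have hinner : Φ (∑ j ∈ Finset.range d, (frobL p k).symm (c (j + 1)) • (Φ ^ j) w) = - (c 0 • w) := by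
    rw [Finset.sum_range_succ'] at hsum
    rw [map_sum, eq_neg_iff_add_eq_zero, ← hsum]
    congr 1
    · refine Finset.sum_congr rfl fun j _ => ?_
      rw [hΦ.smul, RingEquiv.apply_symm_apply, ← End_mul_apply, ← pow_succ']
  have h1 : ∑ j ∈ Finset.range d, (frobL p k).symm (c (j + 1)) • (Φ ^ j) w ∈ D.Fil (e * s + 1) := by
    rw [← D.phi, hinner]
    have : (e : ℤ) * s + 1 + s = d * s + 1 := by rw [he]; push_cast; ring
    rw [this]
    exact Submodule.neg_mem _ hc0
  have h2 := horth _ _ h1 e (by omega)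
  have h3 : (frobL p k).symm (c (e + 1)) = 1 := by rw [← he, hcd, map_one]
  rw [h3] at h2
  have h4 := not_VG_unit (h := 0) (u := 1) (by simp) h2
  rw [div_le_iff₀ hrq] at h4
  push_cast at h4
  linarith

end FilData
end IsoTwo

section IsoThree
variable {p : ℕ} [Fact p.Prime] {k : Type} [Field k] [IsAlgClosed k] [CharP k p]
variable {X : Type} [AddCommGroup X] [Module (K(p, k)) X] [Module (WittVector p k) X]
  [IsScalarTower (WittVector p k) (K(p, k)) X]

local notation "Wk" => WittVector p k
local notation "Lk" => FractionRing (WittVector p k)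

theorem zpow_smul_mem_of_le {M : Submodule (WittVector p k) X} {a b : ℤ} (h : a ≤ b) {x : X}
    (hx : (p : Lk) ^ a • x ∈ M) : (p : Lk) ^ b • x ∈ M := by
  obtain ⟨j, rfl⟩ := Int.le.dest h
  rw [zpow_add₀ pL_ne, mul_comm, mul_smul, zpow_natCast]
  have : (p : Lk) ^ j • ((p : Lk) ^ a • x) = ((p : Wk) ^ j) • ((p : Lk) ^ a • x) := by
    rw [← algebraMap_smul Lk ((p : Wk) ^ j), map_pow, map_natCast]
  rw [this]
  exact Submodule.smul_mem _ _ hx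

theorem exists_pow_smul_mem {M : Submodule (WittVector p k) X} {y : X}
    (hy : y ∈ Submodule.span Lk (M : Set X)) : ∃ N : ℕ, (p : Lk) ^ (N : ℤ) • y ∈ M := by
  induction hy using Submodule.span_induction with
  | mem x hx => exact ⟨0, by simpa using hx⟩
  | zero => exact ⟨0, by simp⟩
  | add x y _ _ hx hy =>
    obtain ⟨N, hN⟩ := hx
    obtain ⟨N', hN'⟩ := hy
    refine ⟨N + N', ?_⟩
    rw [smul_add]
    exact Submodule.add_mem _ (zpow_smul_mem_of_le (by push_cast; omega) hN)
      (zpow_smul_mem_of_le (by push_cast; omega) hN')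
  | smul c x _ hx =>
    obtain ⟨N, hN⟩ := hx
    obtain ⟨m, hm⟩ := exists_VG c
    obtain ⟨a, rfl⟩ := hm.int
    refine ⟨N + m.natAbs, ?_⟩
    rw [mul_smul, algebraMap_smul, smul_smul, ← zpow_add₀ pL_ne, smul_comm]
    exact Submodule.smul_mem _ _ (zpow_smul_mem_of_le (by
      have := neg_abs_le m
      push_cast; linarith) hN)

theorem exists_filData {Φ : AddMonoid.End X} (hΦ : IsSL (p := p) (k := k) Φ) {P : Submodule (K(p, k)) X}
    (hP : ∀ x ∈ P, Φ x ∈ P) {M : Submodule (WittVector p k) X} (hM : M.FG)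
    (hsp : Submodule.span Lk (M : Set X) = P) {r0 : ℕ} {s0 : ℤ} (hr0 : 0 < r0)
    (hper : ∀ x, (p : Lk) ^ (-s0) • (Φ ^ r0) x ∈ M ↔ x ∈ M) {r : ℕ} {s : ℤ} (hr : 0 < r)
    (hrs : (r0 : ℤ) * s = s0 * r) : Nonempty (FilData Φ r s P) := by
  have hPpow : ∀ (a : ℕ), ∀ x ∈ P, (Φ ^ a) x ∈ P := by
    intro a
    induction a with
    | zero => intro x hx; simpa using hx
    | succ a ih => intro x hx; rw [pow_succ, End_mul_apply]; exact ih _ (hP x hx)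
  let Fil : ℤ → Submodule (WittVector p k) X := fun l =>
    { carrier := {x | ∀ (a : ℕ) (b : ℤ), 0 ≤ a * s + b * r + l → (p : Lk) ^ b • (Φ ^ a) x ∈ M}
      zero_mem' := fun a b _ => by simp
      add_mem' := fun {x y} hx hy a b h => by
        rw [map_add, smul_add]; exact Submodule.add_mem _ (hx a b h) (hy a b h)
      smul_mem' := fun c x hx a b h => by
        rw [hΦ.pow_smulW, smul_comm]; exact Submodule.smul_mem _ _ (hx a b h) }
  have hFil : ∀ l x, x ∈ Fil l ↔
      ∀ (a : ℕ) (b : ℤ), 0 ≤ a * s + b * r + l → (p : Lk) ^ b • (Φ ^ a) x ∈ M := fun _ _ => Iff.rfl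
  have hper1 : ∀ (b : ℤ) (a : ℕ) x, (p : Lk) ^ (b - s0) • (Φ ^ (a + r0)) x ∈ M ↔
      (p : Lk) ^ b • (Φ ^ a) x ∈ M := by
    intro b a x
    rw [← hper ((p : Lk) ^ b • (Φ ^ a) x), hΦ.pow_smul_p, smul_smul, ← zpow_add₀ pL_ne,
      ← End_mul_apply, ← pow_add, add_comm r0 a, sub_eq_neg_add]
  have hper2 : ∀ (t : ℕ) (b : ℤ) (a : ℕ) x, (p : Lk) ^ (b - t * s0) • (Φ ^ (a + t * r0)) x ∈ M ↔
      (p : Lk) ^ b • (Φ ^ a) x ∈ M := by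
    intro t
    induction t with
    | zero => intro b a x; simp
    | succ t ih =>
      intro b a x
      rw [← ih b a x, ← hper1 (b - t * s0)]
      have e1 : b - ((t + 1 : ℕ) : ℤ) * s0 = b - t * s0 - s0 := by push_cast; ring
      have e2 : a + (t + 1) * r0 = a + t * r0 + r0 := by ring
      rw [e1, e2]
  have hb : ∀ l x, x ∈ Fil l → (p : Lk) ^ (|l|) • x ∈ M := by
    intro l x hx
    have := hx 0 |l| (by
      have h1 := neg_abs_le l
      have h2 := abs_nonneg l
      have h3 : (1 : ℤ) ≤ r := by omega
      push_cast
      nlinarith)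
    simpa using this
  refine ⟨{ Fil := Fil, anti := ?_, phi := ?_, pp := ?_, fg := ?_, sp := ?_ }⟩
  · intro l x hx a b h
    exact hx a b (by linarith)
  · intro l x
    constructor
    · intro hx a b h
      rw [← hper1 b a x]
      obtain ⟨q, hq⟩ : ∃ q, r0 = q + 1 := ⟨r0 - 1, by omega⟩
      have := hx (a + q) (b - s0) (by
        have e : ((a + q : ℕ) : ℤ) * s + (b - s0) * r + (l + s) = a * s + b * r + l := by
          have : ((q : ℤ) + 1) * s = s0 * r := by rw [← hrs, hq]; push_cast; ring
          push_cast
          linear_combination this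
        rw [e]; exact h)
      rw [← End_mul_apply, ← pow_succ] at this
      rw [hq, ← add_assoc]; exact this
    · intro hx a b h
      rw [← End_mul_apply, ← pow_succ]
      exact hx (a + 1) b (by push_cast; linarith)
  · intro l x
    have e : ∀ (a : ℕ) (b : ℤ), (p : Lk) ^ b • (Φ ^ a) ((p : Lk) • x) = (p : Lk) ^ (b + 1) • (Φ ^ a) x := by
      intro a b
      have := hΦ.pow_smul_p a 1 x
      rw [zpow_one] at this
      rw [this, smul_smul, zpow_add_one₀ pL_ne]
    constructor
    · intro hx a b h
      have := hx a (b - 1) (by linarith)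
      rwa [e, sub_add_cancel] at this
    · intro hx a b h
      rw [e]
      exact hx a (b + 1) (by linarith)
  · intro l
    let f : X →ₗ[Wk] X := DistribSMul.toLinearMap Wk X ((p : Lk) ^ (-|l|))
    have h1 : (M.map f).FG := hM.map f
    refine Submodule.FG.of_le h1 fun x hx => ?_
    refine ⟨(p : Lk) ^ (|l|) • x, hb l x hx, ?_⟩
    change (p : Lk) ^ (-|l|) • ((p : Lk) ^ (|l|) • x) = x
    rw [smul_smul, ← zpow_add₀ pL_ne]; simp
  · intro l
    refine le_antisymm (Submodule.span_le.2 fun x hx => ?_) ?_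
    · have h1 : (p : Lk) ^ (|l|) • x ∈ P := by rw [← hsp]; exact Submodule.subset_span (hb l x hx)
      have h2 := P.smul_mem ((p : Lk) ^ (-|l|)) h1
      rw [smul_smul, ← zpow_add₀ pL_ne] at h2
      simpa using h2
    · rw [← hsp, Submodule.span_le]
      intro x hx
      have hxP : x ∈ P := by rw [← hsp]; exact Submodule.subset_span hx
      choose N hN using fun a => exists_pow_smul_mem (M := M) (y := (Φ ^ a) x) (by
        rw [hsp]; exact hPpow a x hxP)
      obtain ⟨B, hB⟩ := ((Finset.range r0).image N).bddAbove
      set C : ℤ := |l| + r0 * |s| + B with hC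
      have hmem : (p : Lk) ^ C • x ∈ Fil l := by
        intro a b h
        rw [hΦ.pow_smul_p, smul_smul, ← zpow_add₀ pL_ne]
        have ha := Nat.mod_add_div a r0
        have hlt := Nat.mod_lt a hr0
        generalize a % r0 = a0 at ha hlt
        generalize a / r0 = t at ha
        subst ha
        have e1 : b + C = (b + C + t * s0) - t * s0 := by ring
        rw [e1, mul_comm r0 t, hper2]
        refine zpow_smul_mem_of_le ?_ (hN a0)
        have h1 : N a0 ≤ B := hB (by simpa using ⟨a0, hlt, rfl⟩)
        have h2 : (N a0 : ℤ) ≤ B := by exact_mod_cast h1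
        have h3 : 0 ≤ (b + t * s0 + |l| + r0 * |s|) := by
          by_contra! hneg
          have e2 : ((a0 + r0 * t : ℕ) : ℤ) * s + b * r = a0 * s + (b + t * s0) * r := by
            push_cast
            linear_combination t * hrs
          rw [e2] at h
          have h4 : (a0 : ℤ) * s ≤ r0 * |s| := by
            have h5 : s ≤ |s| := le_abs_self s
            have h6 : (0 : ℤ) ≤ |s| := abs_nonneg s
            have h7 : (a0 : ℤ) ≤ r0 := by omega
            have h8 : (0 : ℤ) ≤ a0 := by omega
            nlinarith
          have h9 : l ≤ |l| := le_abs_self l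
          have h10 : (1 : ℤ) ≤ r := by omega
          have h11 : 0 ≤ |l| := abs_nonneg l
          have h12 : (0 : ℤ) ≤ r0 * |s| := by positivity
          have h13 : (b + t * s0) * r ≤ (b + t * s0) := by nlinarith
          linarith
        rw [hC]; linarith
      have h2 := (Submodule.span Lk (Fil l : Set X)).smul_mem ((p : Lk) ^ (-C)) (Submodule.subset_span hmem)
      rw [smul_smul, ← zpow_add₀ pL_ne] at h2
      simpa using h2

end IsoThree

section IsoFour
variable {p : ℕ} [Fact p.Prime] {k : Type} [Field k] [IsAlgClosed k] [CharP k p]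
variable {n : ℕ}

local notation "Wk" => WittVector p k
local notation "Lk" => FractionRing (WittVector p k)

/-- The `σ`-linear bijection as an additive endomorphism. -/
def isocEnd (b : GL (Fin n) (K(p, k))) : AddMonoid.End (Fin n → K(p, k)) where
  toFun := isocFrob p k n b
  map_zero' := by
    have : (fun i : Fin n => frobL p k ((0 : Fin n → K(p, k)) i)) = 0 := by ext i; simp
    unfold isocFrob; rw [this, Matrix.mulVec_zero]
  map_add' x y := by
    have : (fun i : Fin n => frobL p k ((x + y) i)) =
      (fun i : Fin n => frobL p k (x i)) + (fun i : Fin n => frobL p k (y i)) := by ext i; simp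
    unfold isocFrob; rw [this, Matrix.mulVec_add]

theorem isocEnd_apply (b : GL (Fin n) (K(p, k))) (x : Fin n → K(p, k)) :
    isocEnd b x = isocFrob p k n b x := rfl

theorem isocEnd_isSL (b : GL (Fin n) (K(p, k))) : IsSL (p := p) (k := k) (isocEnd b) where
  smul c x := by
    have : (fun i : Fin n => frobL p k ((c • x) i)) = frobL p k c • (fun i : Fin n => frobL p k (x i)) := by
      ext i; simp
    rw [isocEnd_apply, isocEnd_apply]
    unfold isocFrob; rw [this, Matrix.mulVec_smul]
  bij := by
    have h1 : Function.Bijective fun (v : Fin n → K(p, k)) => (b : Matrix (Fin n) (Fin n) (K(p, k))).mulVec v := by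
      refine Function.bijective_iff_has_inverse.2
        ⟨fun v => ((b⁻¹ : GL (Fin n) (K(p, k))) : Matrix (Fin n) (Fin n) (K(p, k))).mulVec v, ?_, ?_⟩
      · intro v
        simp only [Matrix.mulVec_mulVec]
        rw [← Units.val_mul, inv_mul_cancel, Units.val_one, Matrix.one_mulVec]
      · intro v
        simp only [Matrix.mulVec_mulVec]
        rw [← Units.val_mul, mul_inv_cancel, Units.val_one, Matrix.one_mulVec]
    have h2 : Function.Bijective fun (v : Fin n → K(p, k)) => (fun i => frobL p k (v i)) := by
      refine Function.bijective_iff_has_inverse.2 ⟨fun v i => (frobL p k).symm (v i), ?_, ?_⟩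
      · intro v; ext i; simp
      · intro v; ext i; simp
    exact h1.comp h2

theorem isoclinic_filData (b : GL (Fin n) (K(p, k)))
    (P : Submodule (K(p, k)) (Fin n → K(p, k))) (lam : ℚ)
    (hP : isocFrob p k n b '' (P : Set (Fin n → K(p, k))) ⊆ P)
    (h : IsIsoclinicOfSlope p k n b P lam) :
    Nonempty (FilData (p := p) (k := k) (isocEnd b) lam.den lam.num P) := by
  obtain ⟨r0, s0, hr0, hlam, M, hMP, hsp, ⟨S, hS⟩, heq⟩ := h
  have hΦ := isocEnd_isSL (p := p) (k := k) b
  have hr0q : (r0 : ℚ) ≠ 0 := by exact_mod_cast hr0.ne'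
  have hit : ∀ x, (isocFrob p k n b)^[r0] x = (isocEnd b ^ r0) x := by
    intro x; rw [AddMonoid.End.coe_pow]; rfl
  have hL : ∀ z ∈ Submodule.span Wk ((isocFrob p k n b)^[r0] '' (M : Set (Fin n → K(p, k)))),
      ∃ y ∈ M, z = (isocEnd b ^ r0) y := by
    intro z hz
    induction hz using Submodule.span_induction with
    | mem x hx => obtain ⟨y, hy, rfl⟩ := hx; exact ⟨y, hy, hit y⟩
    | zero => exact ⟨0, M.zero_mem, by simp⟩
    | add x y _ _ hx hy =>
      obtain ⟨x', hx', rfl⟩ := hx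
      obtain ⟨y', hy', rfl⟩ := hy
      exact ⟨x' + y', M.add_mem hx' hy', by rw [map_add]⟩
    | smul c x _ hx =>
      obtain ⟨x', hx', rfl⟩ := hx
      refine ⟨(WittVector.frobeniusEquiv p k ^ r0 : RingAut Wk).symm c • x', M.smul_mem _ hx', ?_⟩
      rw [hΦ.pow_smulW, RingEquiv.apply_symm_apply]
  have hR : ∀ z ∈ Submodule.span Wk ((fun x => (p : K(p, k)) ^ s0 • x) '' (M : Set (Fin n → K(p, k)))),
      (p : Lk) ^ (-s0) • z ∈ M := by
    intro z hz
    induction hz using Submodule.span_induction with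
    | mem x hx =>
      obtain ⟨y, hy, rfl⟩ := hx
      simp only [smul_smul]
      rw [← zpow_add₀ pL_ne]; simpa using hy
    | zero => simp
    | add x y _ _ hx hy => rw [smul_add]; exact M.add_mem hx hy
    | smul c x _ hx => rw [smul_comm]; exact M.smul_mem _ hx
  refine exists_filData hΦ (fun x hx => hP ⟨x, hx, rfl⟩) (M := M) ?_ hsp (s0 := s0) hr0 ?_ lam.den_pos ?_
  · rw [hS]; exact ⟨S, rfl⟩
  · intro x
    constructor
    · intro hx
      have h1 : (isocEnd b ^ r0) x ∈ Submodule.span Wk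
          ((fun x => (p : K(p, k)) ^ s0 • x) '' (M : Set (Fin n → K(p, k)))) := by
        refine Submodule.subset_span ⟨_, hx, ?_⟩
        simp only [smul_smul]
        rw [← zpow_add₀ pL_ne]; simp
      rw [← heq] at h1
      obtain ⟨y, hy, e⟩ := hL _ h1
      rw [(hΦ.pow_bij r0).1 e]; exact hy
    · intro hx
      refine hR _ ?_
      rw [← heq, ← hit]
      exact Submodule.subset_span ⟨x, hx, rfl⟩
  · have h1 : (lam.num : ℚ) / lam.den = s0 / r0 := by rw [Rat.num_div_den, hlam]
    have h2 : (lam.den : ℚ) ≠ 0 := by exact_mod_cast lam.den_ne_zero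
    rw [div_eq_div_iff h2 hr0q] at h1
    have h3 : lam.num * r0 = s0 * lam.den := by exact_mod_cast h1
    linarith

end IsoFour

section Glue
variable {p : ℕ} [Fact p.Prime] {k : Type} [Field k] [IsAlgClosed k] [CharP k p]
variable {X : Type} [AddCommGroup X] [Module (K(p, k)) X] [Module (WittVector p k) X]
  [IsScalarTower (WittVector p k) (K(p, k)) X]

local notation "Wk" => WittVector p k
local notation "Lk" => FractionRing (WittVector p k)

/-- Coefficients of the composition of two `σ`-linear operators. -/
def opMul (c c' : ℕ → K(p, k)) (d e : ℕ) (m : ℕ) : K(p, k) :=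
  ∑ i ∈ Finset.range (d + 1), ∑ j ∈ Finset.range (e + 1),
    if i + j = m then c i * (frobL p k ^ i : RingAut (K(p, k))) (c' j) else 0

theorem opMul_apply {Φ : AddMonoid.End X} (hΦ : IsSL (p := p) (k := k) Φ) (c c' : ℕ → Lk) (d e : ℕ) (v : X) :
    ∑ m ∈ Finset.range (d + e + 1), opMul c c' d e m • (Φ ^ m) v =
      ∑ i ∈ Finset.range (d + 1), c i • (Φ ^ i) (∑ j ∈ Finset.range (e + 1), c' j • (Φ ^ j) v) := by
  simp only [opMul, Finset.sum_smul]
  rw [Finset.sum_comm]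
  refine Finset.sum_congr rfl fun i hi => ?_
  rw [Finset.sum_comm, map_sum, Finset.smul_sum]
  refine Finset.sum_congr rfl fun j hj => ?_
  simp only [Finset.mem_range] at hi hj
  simp only [ite_smul, zero_smul]
  rw [Finset.sum_ite_eq, if_pos (by simp; omega), hΦ.pow_smul, smul_smul, pow_add, End_mul_apply]

theorem opMul_top (c c' : ℕ → Lk) (d e : ℕ) (hc : c d = 1) (hc' : c' e = 1) :
    opMul c c' d e (d + e) = 1 := by
  unfold opMul
  rw [Finset.sum_eq_single d, Finset.sum_eq_single e]
  · rw [if_pos rfl, hc, hc', map_one, mul_one]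
  · intro j hj hne; rw [if_neg (by omega)]
  · simp
  · intro i hi hne
    refine Finset.sum_eq_zero fun j hj => ?_
    simp only [Finset.mem_range] at hi hj
    rw [if_neg (by omega)]
  · simp

theorem opMul_zero (c c' : ℕ → Lk) (d e : ℕ) :
    opMul c c' d e 0 = c 0 * c' 0 := by
  unfold opMul
  rw [Finset.sum_eq_single 0, Finset.sum_eq_single 0]
  · simp
  · intro j hj hne; rw [if_neg (by omega)]
  · simp
  · intro i hi hne
    refine Finset.sum_eq_zero fun j hj => ?_
    rw [if_neg (by omega)]
  · simp

theorem opMul_VG {c c' : ℕ → Lk} {d e m : ℕ} {q : ℚ} 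
    (h : ∀ i j, i ≤ d → j ≤ e → i + j = m → ∃ q1 q2, VG (c i) q1 ∧ VG (c' j) q2 ∧ q ≤ q1 + q2) :
    VG (opMul c c' d e m) q := by
  unfold opMul
  refine VG.sum fun i hi => VG.sum fun j hj => ?_
  simp only [Finset.mem_range] at hi hj
  split_ifs with hij
  · obtain ⟨q1, q2, h1, h2, h3⟩ := h i j (by omega) (by omega) hij
    exact (h1.mul (h2.frob i)).mono h3
  · exact VG.zero _

theorem glue {Φ : AddMonoid.End X} (hΦ : IsSL (p := p) (k := k) Φ)
    (P : ℚ → Submodule (K(p, k)) X) (S : Finset ℚ)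
    (hD : ∀ lam ∈ S, Nonempty (FilData (p := p) (k := k) Φ lam.den lam.num (P lam))) :
    ∃ (v : X) (c : ℕ → Lk),
      c (∑ l ∈ S, Module.finrank Lk (P l)) = 1 ∧
      ∑ i ∈ Finset.range (∑ l ∈ S, Module.finrank Lk (P l) + 1), c i • (Φ ^ i) v = 0 ∧
      (∀ U : Submodule Lk X, (∀ i < ∑ l ∈ S, Module.finrank Lk (P l), (Φ ^ i) v ∈ U) →
        ∀ l ∈ S, P l ≤ U) ∧
      (∀ t : ℚ, ∀ i ≤ ∑ l ∈ S, Module.finrank Lk (P l),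
        VG (c i) (((∑ l ∈ S, Module.finrank Lk (P l) : ℕ) - (i : ℚ)) * t -
          ∑ l ∈ S, (Module.finrank Lk (P l) : ℚ) * max (t - l) 0)) ∧
      VG (c 0)⁻¹ (- ∑ l ∈ S, (Module.finrank Lk (P l) : ℚ) * l) := by
  induction S using Finset.induction_on_min with
  | empty =>
    refine ⟨0, fun _ => 1, rfl, by simp, by simp, ?_, ?_⟩
    · intro t i hi
      have : i = 0 := by simpa using hi
      subst this
      exact VG.one (by simp)
    · rw [inv_one]; exact VG.one (by simp)
  | insert a S ha ih =>
    obtain ⟨v2, c2, hc2, hsum2, hsp2, hV2, hi2⟩ := ih fun l hl => hD l (by simp [hl])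
    obtain ⟨D⟩ := hD a (by simp)
    have haS : a ∉ S := fun h => lt_irrefl _ (ha a h)
    simp only [Finset.sum_insert haS]
    generalize he : ∑ l ∈ S, Module.finrank Lk (P l) = e at *
    have hr : 0 < a.den := a.den_pos
    have hrq : (0 : ℚ) < a.den := by exact_mod_cast hr
    have hcop : IsCoprime a.num (a.den : ℤ) := by
      rw [Int.isCoprime_iff_nat_coprime]; simpa using a.reduced
    have hta : (a.num : ℚ) / a.den = a := Rat.num_div_den a
    obtain ⟨t, hat, htS⟩ : ∃ t, a < t ∧ ∀ l ∈ S, t ≤ l := by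
      rcases S.eq_empty_or_nonempty with rfl | hne
      · exact ⟨a + 1, by linarith, by simp⟩
      · exact ⟨S.min' hne, ha _ (S.min'_mem hne), fun l hl => S.min'_le l hl⟩
    obtain ⟨w0, hw0, Hw⟩ := (D.shift (e * a.num)).cyclic hΦ hr hcop
    obtain ⟨x, hx⟩ := (hΦ.pow_bij e).2 w0
    have hw0' : w0 ∈ D.Fil (0 + e * a.num) := hw0
    have hx0 : x ∈ D.Fil 0 := by rw [← D.phi_pow e, hx]; exact hw0'
    have hxj : ∀ j : ℕ, (Φ ^ j) x ∈ D.Fil (j * a.num) := fun j => by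
      have := (D.phi_pow j 0 x).2 hx0
      rwa [zero_add] at this
    have hc2t : ∀ j ≤ e, VG (c2 j) (((e : ℚ) - j) * t) := by
      intro j hj
      refine (hV2 t j hj).mono (le_of_eq ?_)
      rw [Finset.sum_eq_zero, sub_zero]
      intro l hl
      rw [max_eq_right (by linarith [htS l hl]), mul_zero]
    set w := ∑ j ∈ Finset.range (e + 1), c2 j • (Φ ^ j) x with hw
    have hww : w - w0 ∈ (D.shift (e * a.num)).Fil 1 := by
      change w - w0 ∈ D.Fil (1 + e * a.num)
      rw [hw, Finset.sum_range_succ, hc2, one_smul, hx, add_sub_cancel_right]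
      refine Submodule.sum_mem _ fun j hj => ?_
      have hj : j < e := by simpa using hj
      refine D.VG_smul (hc2t j hj.le).ceil (hxj j) ?_
      have h1 := Int.le_ceil (((e : ℚ) - j) * t)
      have h2 : (0 : ℚ) < (e : ℚ) - j := by
        have : (j : ℚ) < e := by exact_mod_cast hj
        linarith
      have h3 : (a.num : ℚ) = a * a.den := by
        rw [eq_comm, ← eq_div_iff hrq.ne', hta]
      have h4 : ((e : ℚ) - j) * a.num < ⌈((e : ℚ) - j) * t⌉ * a.den := by
        calc ((e : ℚ) - j) * a.num = (((e : ℚ) - j) * a) * a.den := by rw [h3]; ring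
          _ < (((e : ℚ) - j) * t) * a.den := by gcongr
          _ ≤ _ := by gcongr
      have h5 : ((e : ℤ) - j) * a.num < ⌈((e : ℚ) - j) * t⌉ * a.den := by exact_mod_cast h4
      linarith
    obtain ⟨c1, hc1, hsum1, hsp1, hV1, hi1⟩ := Hw w hww
    simp only [hta] at hV1 hi1
    generalize hd : Module.finrank Lk (P a) = d at *
    have hopv : ∑ j ∈ Finset.range (e + 1), c2 j • (Φ ^ j) (v2 + x) = w := by
      simp only [map_add, smul_add, Finset.sum_add_distrib]
      rw [hsum2, zero_add]
    have hPaU : ∀ U : Submodule Lk X, (∀ i < d + e, (Φ ^ i) (v2 + x) ∈ U) → P a ≤ U := by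
      intro U hvU
      refine hsp1.trans (Submodule.span_le.2 ?_)
      rintro _ ⟨i, rfl⟩
      change (Φ ^ (i : ℕ)) w ∈ U
      rw [← hopv, map_sum]
      refine Submodule.sum_mem _ fun j hj => ?_
      rw [hΦ.pow_smul, ← End_mul_apply, ← pow_add]
      refine Submodule.smul_mem _ _ (hvU _ ?_)
      have := i.2
      simp only [Finset.mem_range] at hj
      omega
    refine ⟨v2 + x, opMul c1 c2 d e, opMul_top _ _ _ _ hc1 hc2, ?_, ?_, ?_, ?_⟩
    · rw [opMul_apply hΦ, hopv, hsum1]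
    · intro U hvU l hl
      rcases Finset.mem_insert.1 hl with rfl | hl
      · exact hPaU U hvU
      · refine hsp2 U (fun i hi => ?_) l hl
        have h1 : (Φ ^ i) v2 = (Φ ^ i) (v2 + x) - (Φ ^ i) x := by
          rw [map_add, add_sub_cancel_right]
        rw [h1]
        refine Submodule.sub_mem _ (hvU _ (by omega)) (hPaU U hvU ?_)
        rw [← D.sp (i * a.num)]
        exact Submodule.subset_span (hxj i)
    · intro u m hm
      refine opMul_VG fun i j hi hj hij => ⟨_, _, hV1 i hi, hV2 u j hj, ?_⟩
      rw [← hij]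
      push_cast
      have h1 : (0 : ℚ) ≤ (d : ℚ) - i := by
        have : (i : ℚ) ≤ d := by exact_mod_cast hi
        linarith
      have h2 : ((d : ℚ) - i) * (u - a) ≤ d * max (u - a) 0 := by
        have h3 : u - a ≤ max (u - a) 0 := le_max_left _ _
        have h4 : (0 : ℚ) ≤ max (u - a) 0 := le_max_right _ _
        have h5 : (0 : ℚ) ≤ i := by positivity
        nlinarith
      linarith
    · rw [opMul_zero, mul_inv]
      refine (hi1.mul hi2).mono (le_of_eq ?_)
      ring

theorem sum_max_sub {n : ℕ} (ν : Fin n → ℚ) (hν : ∀ i j : Fin n, i ≤ j → ν j ≤ ν i) (i : Fin n) :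
    ((n : ℚ) - (i : ℕ)) * ν i - ∑ j, max (ν i - ν j) 0 =
      ∑ j : Fin n, if (i : ℕ) ≤ (j : ℕ) then ν j else 0 := by
  have h1 : ((n : ℚ) - (i : ℕ)) = ∑ j : Fin n, if (i : ℕ) ≤ (j : ℕ) then (1 : ℚ) else 0 := by
    rw [Finset.sum_boole]
    have : (Finset.univ.filter fun j : Fin n => (i : ℕ) ≤ (j : ℕ)) = Finset.Ici i := by
      ext j; rw [Finset.mem_filter, Finset.mem_Ici, Fin.le_def]; simp only [Finset.mem_univ, true_and]
    rw [this, Fin.card_Ici, Nat.cast_sub i.2.le]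
  rw [h1, Finset.sum_mul, ← Finset.sum_sub_distrib]
  refine Finset.sum_congr rfl fun j _ => ?_
  split_ifs with h
  · rw [max_eq_left (by linarith [hν i j h])]; ring
  · rw [max_eq_right (by linarith [hν j i (by rw [Fin.le_def]; omega)])]; ring

end Glue

section Final
variable {p : ℕ} [Fact p.Prime] {k : Type} [Field k] [IsAlgClosed k] [CharP k p]
variable {n : ℕ}

local notation "Wk" => WittVector p k
local notation "Lk" => FractionRing (WittVector p k)

theorem newton_cyclic (b : GL (Fin n) (K(p, k))) (ν : Fin n → ℚ) (hν : IsNewtonVector p k n b ν) :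
    ∃ (v : Fin n → K(p, k)) (c : ℕ → Lk),
      c n = 1 ∧ ∑ i ∈ Finset.range (n + 1), c i • (isocEnd b ^ i) v = 0 ∧
      ⊤ ≤ Submodule.span Lk (Set.range fun i : Fin n => (isocEnd b ^ (i : ℕ)) v) ∧
      (∀ i : Fin n, VG (c i) (∑ j : Fin n, if (i : ℕ) ≤ (j : ℕ) then ν j else 0)) ∧
      VG (c 0)⁻¹ (- ∑ j, ν j) := by
  classical
  obtain ⟨hanti, P, _, htop, hst, hfr, hiso⟩ := hν
  set S := Finset.univ.image ν with hS
  have hsum : ∀ f : ℚ → ℚ, ∑ l ∈ S, (Module.finrank Lk (P l) : ℚ) * f l = ∑ i, f (ν i) := by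
    intro f
    rw [Finset.sum_comp f ν]
    refine Finset.sum_congr rfl fun l _ => ?_
    rw [hfr, nsmul_eq_mul]
  have hn : ∑ l ∈ S, Module.finrank Lk (P l) = n := by
    have := hsum fun _ => 1
    simp only [mul_one, Finset.sum_const, Finset.card_univ, Fintype.card_fin, nsmul_eq_mul] at this
    exact_mod_cast this
  have hz : ∀ l ∉ S, P l = ⊥ := by
    intro l hl
    rw [← Submodule.finrank_eq_zero (R := Lk), hfr, Finset.card_eq_zero, Finset.filter_eq_empty_iff]
    intro i _ h
    exact hl (by rw [hS, Finset.mem_image]; exact ⟨i, by simp, h⟩)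
  obtain ⟨v, c, h1, h2, h3, h4, h5⟩ := glue (isocEnd_isSL b) P S (fun l hl => by
    refine isoclinic_filData b (P l) l (hst l) ((hiso l).resolve_left fun h => ?_)
    obtain ⟨i, _, rfl⟩ := Finset.mem_image.1 hl
    have h0 := hfr (ν i)
    rw [h, finrank_bot] at h0
    have : i ∈ Finset.univ.filter fun j : Fin n => ν j = ν i := by simp
    rw [Finset.card_eq_zero.1 h0.symm] at this
    simp at this)
  simp only [hsum] at h4
  rw [hsum fun l => l] at h5
  rw [hn] at h1 h2 h3 h4
  refine ⟨v, c, h1, h2, ?_, ?_, h5⟩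
  · rw [← htop]
    refine iSup_le fun l => ?_
    by_cases hl : l ∈ S
    · refine h3 _ (fun i hi => ?_) l hl
      exact Submodule.subset_span ⟨⟨i, hi⟩, rfl⟩
    · rw [hz l hl]; exact bot_le
  · intro i
    rw [← sum_max_sub ν hanti i]
    exact h4 (ν i) i i.2.le

end Final

section Last
variable {p : ℕ} [Fact p.Prime] {k : Type} [Field k] [IsAlgClosed k] [CharP k p]

local notation "Wk" => WittVector p k
local notation "Lk" => FractionRing (WittVector p k)

theorem partialSum_eq {n : ℕ} (ν : Fin n → ℚ) (m : ℕ → ℚ) (hm : ∀ i : Fin n, m i = ν i) {r : ℕ}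
    (hr : r ≤ n) : partialSum n ν r = ∑ j ∈ Finset.range r, m j := by
  unfold partialSum
  rw [Finset.sum_filter]
  have h1 : ∑ i : Fin n, (if (i : ℕ) < r then ν i else 0) =
      ∑ i ∈ Finset.range n, if i < r then m i else 0 := by
    rw [Finset.sum_range]
    refine Finset.sum_congr rfl fun i _ => ?_
    rw [hm]
  rw [h1, ← Finset.sum_filter]
  refine Finset.sum_congr ?_ fun _ _ => rfl
  ext j
  simp only [Finset.mem_filter, Finset.mem_range]
  omega

theorem partialSum_compl {n : ℕ} (ν : Fin n → ℚ) (i : ℕ) :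
    (∑ j : Fin n, if i ≤ (j : ℕ) then ν j else 0) = partialSum n ν n - partialSum n ν i := by
  unfold partialSum
  rw [Finset.sum_filter, Finset.sum_filter, ← Finset.sum_sub_distrib]
  refine Finset.sum_congr rfl fun j _ => ?_
  have := j.2
  by_cases h : i ≤ (j : ℕ)
  · rw [if_pos h, if_pos this, if_neg (by omega), sub_zero]
  · rw [if_neg h, if_pos this, if_pos (by omega), sub_self]

theorem final_lattice {N : ℕ} (b : GL (Fin (N + 1)) (K(p, k)))
    (m T : ℕ → ℤ) (hT0 : T 0 = 0) (hT : ∀ i, T (i + 1) = T i + m i)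
    (v : Fin (N + 1) → K(p, k)) (c : ℕ → Lk) (hc : c (N + 1) = 1)
    (hsum : ∑ i ∈ Finset.range (N + 1 + 1), c i • (isocEnd b ^ i) v = 0)
    (hspan : ⊤ ≤ Submodule.span Lk (Set.range fun i : Fin (N + 1) => (isocEnd b ^ (i : ℕ)) v))
    (hV : ∀ i < N + 1, VG (c i) ((T (N + 1) - T i : ℤ) : ℚ))
    (hV0 : VG (c 0)⁻¹ ((- T (N + 1) : ℤ) : ℚ)) (h0 : c 0 ≠ 0) :
    ∃ M : Submodule (WittVector p k) (Fin (N + 1) → K(p, k)),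
      IsLattice p k (N + 1) M ∧
        RelPos p k (N + 1) M (latImage p k (N + 1) b M) (fun i => m i) := by
  have hΦ := isocEnd_isSL (p := p) (k := k) b
  set Φ := isocEnd (p := p) (k := k) b with hΦd
  let C : ℕ → ℤ := fun i => m 0 - T (i + 1)
  let e : ℕ → (Fin (N + 1) → K(p, k)) := fun i => (p : Lk) ^ (C i) • (Φ ^ i) v
  let f : ℕ → (Fin (N + 1) → K(p, k)) := fun i => (p : Lk) ^ (m i) • e i
  have hex : ∀ i, ∃ u : Wk, i < N + 1 → c i = (p : Lk) ^ (T (N + 1) - T i) * algebraMap Wk Lk u := by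
    intro i
    by_cases hi : i < N + 1
    · obtain ⟨a, ha⟩ := (hV i hi).int
      exact ⟨a, fun _ => ha⟩
    · exact ⟨0, fun h => absurd h hi⟩
  choose u hu using hex
  obtain ⟨u', hu'⟩ := hV0.int
  have huu : u' * u 0 = 1 := by
    apply IsFractionRing.injective Wk Lk
    rw [map_mul, map_one, ← inv_mul_cancel₀ h0, hu', hu 0 (by omega), hT0]
    have h1 : (p : Lk) ^ (-T (N + 1)) * (p : Lk) ^ (T (N + 1) - 0) = 1 := by
      rw [← zpow_add₀ pL_ne]; simp
    linear_combination (-(algebraMap Wk Lk u' * algebraMap Wk Lk (u 0))) * h1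
  have hstep : ∀ i, Φ (e i) = f (i + 1) := by
    intro i
    have h1 := hΦ.pow_smul_p 1 (C i) ((Φ ^ i) v)
    rw [pow_one, ← End_mul_apply, ← pow_succ'] at h1
    change Φ ((p : Lk) ^ (C i) • (Φ ^ i) v) = (p : Lk) ^ (m (i + 1)) • ((p : Lk) ^ (C (i + 1)) • (Φ ^ (i + 1)) v)
    rw [h1, smul_smul, ← zpow_add₀ pL_ne]
    congr 2
    simp only [C]
    rw [hT (i + 1)]; ring
  have hlast : Φ (e N) + ∑ i ∈ Finset.range (N + 1), u i • f i = 0 := by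
    have h1 := hΦ.pow_smul_p 1 (C N) ((Φ ^ N) v)
    rw [pow_one, ← End_mul_apply, ← pow_succ'] at h1
    have h2 : Φ (e N) = (p : Lk) ^ (C N) • (Φ ^ (N + 1)) v := h1
    rw [Finset.sum_range_succ, hc, one_smul] at hsum
    have h3 := congrArg (fun x => (p : Lk) ^ (C N) • x) hsum
    simp only [smul_add, smul_zero, Finset.smul_sum] at h3
    rw [h2]
    refine (add_comm _ _).trans (Eq.trans ?_ h3)
    congr 1
    refine Finset.sum_congr rfl fun i hi => ?_
    have hi : i < N + 1 := by simpa using hi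
    change u i • ((p : Lk) ^ (m i) • ((p : Lk) ^ (C i) • (Φ ^ i) v)) = _
    rw [← algebraMap_smul Lk (u i), hu i hi, smul_smul, smul_smul, smul_smul]
    congr 1
    rw [← mul_assoc, ← zpow_add₀ pL_ne, mul_assoc, ← zpow_add₀ pL_ne, mul_comm]
    congr 2
    simp only [C]
    rw [hT i]; ring
  have hli : LinearIndependent Lk (fun i : Fin (N + 1) => e i) := by
    refine linearIndependent_of_top_le_span_of_card_eq_finrank (hspan.trans ?_) (by simp)
    rw [Submodule.span_le]
    rintro _ ⟨i, rfl⟩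
    have h1 : (Φ ^ (i : ℕ)) v = (p : Lk) ^ (-C i) • e i := by
      change _ = (p : Lk) ^ (-C i) • ((p : Lk) ^ (C i) • (Φ ^ (i : ℕ)) v)
      rw [smul_smul, ← zpow_add₀ pL_ne]; simp
    change (Φ ^ (i : ℕ)) v ∈ _
    rw [h1]
    exact Submodule.smul_mem _ _ (Submodule.subset_span ⟨i, rfl⟩)
  refine ⟨Submodule.span Wk (Set.range fun i : Fin (N + 1) => e i), ⟨_, hli, rfl⟩, _, hli, rfl, ?_⟩
  change Submodule.span Wk (isocFrob p k (N + 1) b '' _) =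
    Submodule.span Wk (Set.range fun i : Fin (N + 1) => f i)
  have hfR : ∀ i < N + 1, f i ∈ Submodule.span Wk (Set.range fun i : Fin (N + 1) => f i) :=
    fun i hi => Submodule.subset_span ⟨⟨i, hi⟩, rfl⟩
  apply le_antisymm
  · rw [Submodule.span_le]
    rintro _ ⟨x, hx, rfl⟩
    change Φ x ∈ Submodule.span Wk (Set.range fun i : Fin (N + 1) => f i)
    replace hx : x ∈ Submodule.span Wk (Set.range fun i : Fin (N + 1) => e i) := hx
    induction hx using Submodule.span_induction with
    | mem x hx =>
      obtain ⟨i, rfl⟩ := hx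
      change Φ (e i) ∈ _
      by_cases hi : (i : ℕ) + 1 < N + 1
      · rw [hstep]; exact hfR _ hi
      · have : (i : ℕ) = N := by have := i.2; omega
        rw [this, eq_neg_of_add_eq_zero_left hlast]
        refine Submodule.neg_mem _ (Submodule.sum_mem _ fun j hj => ?_)
        exact Submodule.smul_mem _ _ (hfR j (by simpa using hj))
    | zero => rw [map_zero]; exact Submodule.zero_mem _
    | add x y _ _ hx hy => rw [map_add]; exact Submodule.add_mem _ hx hy
    | smul a x _ hx =>
      have := hΦ.pow_smulW 1 a x
      rw [pow_one, pow_one] at this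
      rw [this]; exact Submodule.smul_mem _ _ hx
  · rw [Submodule.span_le]
    rintro _ ⟨i, rfl⟩
    change f i ∈ Submodule.span Wk (isocFrob p k (N + 1) b '' _)
    have hΦe : ∀ i < N + 1, Φ (e i) ∈ Submodule.span Wk (isocFrob p k (N + 1) b ''
        ((Submodule.span Wk (Set.range fun i : Fin (N + 1) => e i) :
          Submodule Wk (Fin (N + 1) → K(p, k))) : Set (Fin (N + 1) → K(p, k)))) := fun i hi =>
      Submodule.subset_span ⟨e i, Submodule.subset_span ⟨⟨i, hi⟩, rfl⟩, rfl⟩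
    have hi := i.2
    generalize (i : ℕ) = j at hi ⊢
    have hpos : ∀ j, j + 1 < N + 1 → f (j + 1) ∈ Submodule.span Wk (isocFrob p k (N + 1) b ''
        ((Submodule.span Wk (Set.range fun i : Fin (N + 1) => e i) :
          Submodule Wk (Fin (N + 1) → K(p, k))) : Set (Fin (N + 1) → K(p, k)))) := by
      intro j hj
      rw [← hstep]; exact hΦe j (by omega)
    cases j with
    | succ j => exact hpos j hi
    | zero =>
      rw [Finset.sum_range_succ'] at hlast
      have h1 : u 0 • f 0 = -(Φ (e N) + ∑ i ∈ Finset.range N, u (i + 1) • f (i + 1)) := by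
        rw [eq_neg_iff_add_eq_zero, ← hlast]; abel
      have h2 : f 0 = u' • (u 0 • f 0) := by rw [smul_smul, huu, one_smul]
      rw [h2, h1]
      refine Submodule.smul_mem _ _ (Submodule.neg_mem _ (Submodule.add_mem _ (hΦe N (by omega)) ?_))
      refine Submodule.sum_mem _ fun j hj => Submodule.smul_mem _ _ (hpos j ?_)
      have : j < N := by simpa using hj
      omega

end Last

/-- Kottwitz–Rapoport, converse of Mazur's inequality for `GL_n`.
Let `b ∈ GL_n(L)` and let `(N, Φ) = (Lⁿ, b∘σ)` be the associated isocrystal with Newton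
vector `ν̄_b`. If `μ ∈ (ℤⁿ)₊` satisfies `ν̄_b ≤ μ` in the dominance order, then there
exists an `O`-lattice `M` in `N` with `inv(M, Φ(M)) = μ`. -/
theorem converse_mazur_inequality
    (p : ℕ) [Fact p.Prime] (k : Type) [Field k] [IsAlgClosed k] [CharP k p]
    (n : ℕ) (b : GL (Fin n) (K(p, k)))
    (ν : Fin n → ℚ) (hν : IsNewtonVector p k n b ν)
    (μ : Fin n → ℤ) (hμdom : ∀ i j : Fin n, i ≤ j → μ j ≤ μ i)
    (hle : DomLE n ν (fun i => (μ i : ℚ))) :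
    ∃ M : Submodule (WittVector p k) (Fin n → K(p, k)),
      IsLattice p k n M ∧ RelPos p k n M (latImage p k n b M) μ := by
  rcases n with _ | N
  · refine ⟨⊥, ⟨0, linearIndependent_empty_type, ?_⟩, 0, linearIndependent_empty_type, ?_, ?_⟩
    · exact Subsingleton.elim _ _
    · exact Subsingleton.elim _ _
    · exact Subsingleton.elim _ _
  obtain ⟨v, c, hc, hsum, hspan, hV, hV0⟩ := newton_cyclic b ν hν
  let m : ℕ → ℤ := fun j => if h : j < N + 1 then μ ⟨j, h⟩ else 0
  let T : ℕ → ℤ := fun r => ∑ j ∈ Finset.range r, m j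
  have hm : ∀ i : Fin (N + 1), m i = μ i := fun i => dif_pos i.2
  have hps : ∀ r ≤ N + 1, partialSum (N + 1) (fun i => (μ i : ℚ)) r = T r := by
    intro r hr
    rw [partialSum_eq _ (fun j => (m j : ℚ)) (fun i => by rw [hm]) hr]
    simp [T]
  have h0 : c 0 ≠ 0 := by
    intro h0
    have hli : LinearIndependent (K(p, k)) (fun i : Fin (N + 1) => (isocEnd b ^ (i : ℕ)) v) :=
      linearIndependent_of_top_le_span_of_card_eq_finrank hspan (by simp)
    have hΦ := isocEnd_isSL (p := p) (k := k) b
    rw [Finset.sum_range_succ', h0, zero_smul, add_zero] at hsum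
    have h1 : isocEnd b (∑ j ∈ Finset.range (N + 1),
        (frobL p k).symm (c (j + 1)) • (isocEnd b ^ j) v) = 0 := by
      rw [map_sum, ← hsum]
      refine Finset.sum_congr rfl fun j _ => ?_
      rw [hΦ.smul, RingEquiv.apply_symm_apply, ← End_mul_apply, ← pow_succ']
    have h2 := hΦ.bij.1 (h1.trans (map_zero (isocEnd b)).symm)
    rw [Finset.sum_range] at h2
    have h3 := Fintype.linearIndependent_iff.1 hli
      (fun j => (frobL p k).symm (c ((j : ℕ) + 1))) h2 (Fin.last N)
    simp [hc] at h3
  have := final_lattice b m T (by simp [T]) (fun i => Finset.sum_range_succ _ _) v c hc hsum hspan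
    (fun i hi => (hV ⟨i, hi⟩).mono ?_) (hV0.mono ?_) h0
  · simp only [hm] at this
    exact this
  · change _ ≤ ∑ j : Fin (N + 1), if i ≤ (j : ℕ) then ν j else 0
    rw [partialSum_compl, hle.2]
    push_cast
    rw [hps _ le_rfl, ← hps i hi.le]
    linarith [hle.1 i hi]
  · have h1 := hle.2
    rw [hps _ le_rfl] at h1
    have h2 := partialSum_compl ν 0
    simp only [Nat.zero_le, if_true] at h2
    have h3 : partialSum (N + 1) ν 0 = 0 := by simp [partialSum]
    rw [h2, h1, h3]
    push_cast
    linarith
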